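/- arXiv:2201.11424 — 2 statements merged into one kernel-verified Lean document; each statement's English description precedes it below -/
import Mathlib

section
/- (Closed-form recovery of the conditional expectations and community proportions.) Under the weighted stochastic block model, suppose the l×r matrix G with entries (G)_{l',z} := E(α_{l'}(X_{i,j}) | Z_i = z) has full column rank r. For a measurable φ : ℝ → ℝ with φ(X_{i,j}) integrable, define the l×l matrices (M_φ)_{l_1,l_2} := E(α_{l_1}(X_{1,2}) φ(X_{1,3}) α_{l_2}(X_{3,4})) for distinct nodes 1, 2, 3, 4, and M_1 the same with φ ≡ 1. Then, writing H_φ := (GᵀG)⁻¹ Gᵀ M_φ G (GᵀG)⁻¹ and H_1 := (GᵀG)⁻¹ Gᵀ M_1 G (GᵀG)⁻¹, one has (H_1)_{z_1,z_2} = p_{z_1} p_{z_2} > 0, p_z = √((H_1)_{z,z}), and E(φ(X_{i,j}) | Z_i = z_1, Z_j = z_2) = (H_φ)_{z_1,z_2} / (H_1)_{z_1,z_2} for all z_1, z_2 ∈ {1,…,r}. -/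
open MeasureTheory

/-- The weighted stochastic block model on `n` nodes with `r` latent communities:
community labels `Z i` are i.i.d. with distribution `p`; edge weights `X i j = X j i`
are, conditionally on the labels, mutually independent with conditional CDF
`F (Z i) (Z j)` (encoded through the joint conditional CDF factorization `X_cond`). -/
structure SBM (Ω : Type) [MeasurableSpace Ω] (ℙ : Measure Ω) (n r : ℕ) where
  /-- the community distribution -/
  p : Fin r → ℝ
  /-- the community labels -/
  Z : Fin n → Ω → Fin r
  /-- the edge weights -/
  X : Fin n → Fin n → Ω → ℝ
  /-- the conditional CDFs -/
  F : Fin r → Fin r → ℝ → ℝ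
  prob : IsProbabilityMeasure ℙ
  p_pos : ∀ z, 0 < p z
  p_sum : ∑ z, p z = 1
  Z_meas : ∀ i, Measurable (Z i)
  X_meas : ∀ i j, Measurable (X i j)
  X_symm : ∀ i j, X i j = X j i
  F_symm : ∀ z₁ z₂, F z₁ z₂ = F z₂ z₁
  /-- the labels are i.i.d. with distribution `p` -/
  Z_iid : ∀ z : Fin n → Fin r,
    ℙ {ω | ∀ i, Z i ω = z i} = ENNReal.ofReal (∏ i, p (z i))
  /-- conditionally on the labels, the edge weights are mutually independent and the
  conditional CDF of `X i j` given `Z i = z i`, `Z j = z j` is `F (z i) (z j)` -/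
  X_cond : ∀ (z : Fin n → Fin r) (S : Finset (Fin n × Fin n)),
    (∀ q ∈ S, q.1 < q.2) → ∀ x : Fin n × Fin n → ℝ,
      ℙ ({ω | ∀ q ∈ S, X q.1 q.2 ω ≤ x q} ∩ {ω | ∀ i, Z i ω = z i})
        = ENNReal.ofReal ((∏ q ∈ S, F (z q.1) (z q.2) (x q)) * ∏ i, p (z i))

namespace SBMaux

open ProbabilityTheory (iIndepFun iIndepSets iIndepFun_iff_iIndep iIndepSets_iff cond_apply
  cond_isProbabilityMeasure)

variable {Ω : Type} [MeasurableSpace Ω] {ℙ : Measure Ω} {n r : ℕ}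

/-- the event that the labels equal `z` -/
def A (sbm : SBM Ω ℙ n r) (z : Fin n → Fin r) : Set Ω := {ω | ∀ i, sbm.Z i ω = z i}

/-- the weight of the label vector -/
def w (p : Fin r → ℝ) (z : Fin n → Fin r) : ℝ := ∏ i, p (z i)

lemma w_pos (sbm : SBM Ω ℙ n r) (z : Fin n → Fin r) : 0 < w sbm.p z :=
  Finset.prod_pos fun i _ => sbm.p_pos _

lemma A_meas (sbm : SBM Ω ℙ n r) (z : Fin n → Fin r) : MeasurableSet (A sbm z) := by
  have : A sbm z = ⋂ i, sbm.Z i ⁻¹' {z i} := by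
    ext ω; simp [A]
  rw [this]
  exact MeasurableSet.iInter fun i => sbm.Z_meas i (measurableSet_singleton _)

lemma P_A (sbm : SBM Ω ℙ n r) (z : Fin n → Fin r) : ℙ (A sbm z) = ENNReal.ofReal (w sbm.p z) :=
  sbm.Z_iid z

lemma F_nonneg (sbm : SBM Ω ℙ n r) (hn : 4 ≤ n) (s t : Fin r) (x : ℝ) : 0 ≤ sbm.F s t x := by
  by_contra! hneg
  let z : Fin n → Fin r := fun i => if i.val = 0 ∨ i.val = 2 then s else t
  let a : Fin n := ⟨0, by omega⟩
  let b : Fin n := ⟨1, by omega⟩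
  let c : Fin n := ⟨2, by omega⟩
  let d : Fin n := ⟨3, by omega⟩
  have hw := w_pos sbm z
  have h1 := sbm.X_cond z {(a, b)} (by simp [a, b]) (fun _ => x)
  have h2 := sbm.X_cond z {(a, b), (c, d)} (by simp [a, b, c, d]) (fun _ => x)
  have hza : z a = s := by simp [z, a]
  have hzb : z b = t := by simp [z, b]
  have hzc : z c = s := by simp [z, c]
  have hzd : z d = t := by simp [z, d]
  have hne : (a, b) ≠ (c, d) := by simp [a, b, c, d]
  rw [Finset.prod_singleton] at h1
  rw [Finset.prod_pair hne] at h2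
  simp only [hza, hzb, hzc, hzd] at h1 h2
  rw [show (∏ i, sbm.p (z i)) = w sbm.p z from rfl] at h1 h2
  rw [ENNReal.ofReal_of_nonpos (mul_nonpos_of_nonpos_of_nonneg hneg.le hw.le)] at h1
  have h3 : ENNReal.ofReal (sbm.F s t x * sbm.F s t x * w sbm.p z) ≤ 0 := by
    rw [← h2, ← h1]
    apply measure_mono
    rintro ω ⟨h, h'⟩
    refine ⟨fun q hq => h q ?_, h'⟩
    simp only [Finset.mem_singleton] at hq
    simp [hq]
  have h4 : 0 < sbm.F s t x * sbm.F s t x * w sbm.p z := by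
    have := mul_pos_of_neg_of_neg hneg hneg
    positivity
  have := ENNReal.ofReal_pos.2 h4
  exact absurd h3 (not_le.2 this)

/-- conditional measure given the label vector -/
noncomputable def μ (sbm : SBM Ω ℙ n r) (z : Fin n → Fin r) : Measure Ω := ProbabilityTheory.cond ℙ (A sbm z)

lemma μ_prob (sbm : SBM Ω ℙ n r) (z : Fin n → Fin r) : IsProbabilityMeasure (μ sbm z) := by
  have := sbm.prob
  apply cond_isProbabilityMeasure
  rw [P_A]
  exact (ENNReal.ofReal_pos.2 (w_pos sbm z)).ne'

lemma μ_inter (sbm : SBM Ω ℙ n r) (hn : 4 ≤ n) (z : Fin n → Fin r)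
    (S : Finset (Fin n × Fin n)) (hS : ∀ q ∈ S, q.1 < q.2) (x : Fin n × Fin n → ℝ) :
    μ sbm z {ω | ∀ q ∈ S, sbm.X q.1 q.2 ω ≤ x q}
      = ∏ q ∈ S, ENNReal.ofReal (sbm.F (z q.1) (z q.2) (x q)) := by
  have := sbm.prob
  have hw := w_pos sbm z
  rw [μ, cond_apply (A_meas sbm z), P_A, Set.inter_comm]
  have h := sbm.X_cond z S hS x
  rw [A, h, mul_comm (∏ q ∈ S, _), ENNReal.ofReal_mul (by exact hw.le), ← mul_assoc]
  change (ENNReal.ofReal (w sbm.p z))⁻¹ * ENNReal.ofReal (w sbm.p z) * _ = _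
  rw [ENNReal.inv_mul_cancel (ENNReal.ofReal_pos.2 hw).ne' ENNReal.ofReal_ne_top, one_mul,
    ENNReal.ofReal_prod_of_nonneg]
  intro q _
  exact F_nonneg sbm hn _ _ _

lemma μ_single_lt (sbm : SBM Ω ℙ n r) (hn : 4 ≤ n) (z : Fin n → Fin r) (i j : Fin n)
    (hij : i < j) (x : ℝ) :
    μ sbm z {ω | sbm.X i j ω ≤ x} = ENNReal.ofReal (sbm.F (z i) (z j) x) := by
  have := μ_inter sbm hn z {(i, j)} (by simpa using hij) (fun _ => x)
  simpa using this

lemma μ_single (sbm : SBM Ω ℙ n r) (hn : 4 ≤ n) (z : Fin n → Fin r) (i j : Fin n)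
    (hij : i ≠ j) (x : ℝ) :
    μ sbm z {ω | sbm.X i j ω ≤ x} = ENNReal.ofReal (sbm.F (z i) (z j) x) := by
  rcases lt_or_gt_of_ne hij with h | h
  · exact μ_single_lt sbm hn z i j h x
  · rw [sbm.X_symm, sbm.F_symm]
    exact μ_single_lt sbm hn z j i h x

/-- the law of an edge weight given its labels -/
lemma exists_law (sbm : SBM Ω ℙ n r) (hn : 4 ≤ n) :
    ∃ ν : Fin r → Fin r → Measure ℝ, ∀ z i j, i ≠ j →
      (μ sbm z).map (sbm.X i j) = ν (z i) (z j) := by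
  let a : Fin n := ⟨0, by omega⟩
  let b : Fin n := ⟨1, by omega⟩
  have hab : a ≠ b := by simp [a, b]
  refine ⟨fun s t => (μ sbm (fun i => if i = a then s else t)).map (sbm.X a b), ?_⟩
  intro z i j hij
  have h1 := μ_prob sbm z
  have h2 := μ_prob sbm (fun k => if k = a then z i else z j)
  have h3 : IsProbabilityMeasure ((μ sbm z).map (sbm.X i j)) :=
    Measure.isProbabilityMeasure_map (sbm.X_meas i j).aemeasurable
  apply Measure.ext_of_Iic
  intro x
  rw [Measure.map_apply (sbm.X_meas _ _) measurableSet_Iic,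
    Measure.map_apply (sbm.X_meas _ _) measurableSet_Iic]
  have e1 := μ_single sbm hn z i j hij x
  have e2 := μ_single sbm hn (fun k => if k = a then z i else z j) a b hab x
  simp only [if_true, if_neg hab.symm] at e2
  exact e1.trans e2.symm

/-- edges -/
abbrev E (n : ℕ) := {q : Fin n × Fin n // q.1 < q.2}

lemma indep (sbm : SBM Ω ℙ n r) (hn : 4 ≤ n) (z : Fin n → Fin r) :
    iIndepFun (fun e : E n => sbm.X e.1.1 e.1.2) (μ sbm z) := by
  rw [iIndepFun_iff_iIndep]
  refine iIndepSets.iIndep (fun e => (sbm.X_meas _ _).comap_le)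
    (fun e => {s | ∃ t ∈ Set.range (Set.Iic : ℝ → Set ℝ), sbm.X e.1.1 e.1.2 ⁻¹' t = s})
    (fun e => isPiSystem_Iic.comap _) ?_ ?_
  · intro e
    rw [BorelSpace.measurable_eq (α := ℝ), borel_eq_generateFrom_Iic,
      MeasurableSpace.comap_generateFrom]
    rfl
  · rw [iIndepSets_iff]
    intro S f hf
    have : ∀ e : E n, ∃ x : ℝ, e ∈ S → f e = {ω | sbm.X e.1.1 e.1.2 ω ≤ x} := by
      intro e
      by_cases he : e ∈ S
      · obtain ⟨t, ⟨x, rfl⟩, h⟩ := hf e he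
        exact ⟨x, fun _ => h.symm⟩
      · exact ⟨0, fun h => absurd h he⟩
    choose x hx using this
    let y : Fin n × Fin n → ℝ := fun q => if h : q.1 < q.2 then x ⟨q, h⟩ else 0
    have hy : ∀ e : E n, y e.1 = x e := fun e => by simp [y, e.2]
    have h := μ_inter sbm hn z (S.map (Function.Embedding.subtype _))
      (by
        intro q hq
        simp only [Finset.mem_map, Function.Embedding.subtype_apply] at hq
        obtain ⟨e, _, rfl⟩ := hq
        exact e.2) y
    rw [Finset.prod_map] at h
    simp only [Function.Embedding.subtype_apply, hy] at h
    have h1 : (⋂ e ∈ S, f e) = {ω | ∀ q ∈ S.map (Function.Embedding.subtype _),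
        sbm.X q.1 q.2 ω ≤ y q} := by
      ext ω
      simp only [Set.mem_iInter, Set.mem_ofPred_eq, Finset.mem_map,
        Function.Embedding.subtype_apply]
      constructor
      · rintro h q ⟨e, he, rfl⟩
        have := h e he
        rw [hx e he] at this
        rw [hy]; exact this
      · intro h e he
        rw [hx e he]
        have := h e.1 ⟨e, he, rfl⟩
        rw [hy] at this; exact this
    rw [h1, h]
    refine Finset.prod_congr rfl fun e he => ?_
    rw [hx e he, μ_single_lt sbm hn z _ _ e.2]

/-- the edge on two distinct nodes -/
def edge (i j : Fin n) (h : i ≠ j) : E n :=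
  if hl : i < j then ⟨(i, j), hl⟩ else ⟨(j, i), lt_of_le_of_ne (not_lt.1 hl) h.symm⟩

lemma X_edge (sbm : SBM Ω ℙ n r) (i j : Fin n) (h : i ≠ j) :
    sbm.X (edge i j h).1.1 (edge i j h).1.2 = sbm.X i j := by
  unfold edge
  split_ifs
  · rfl
  · exact sbm.X_symm _ _

lemma edge_eq (i j k m : Fin n) (h : i ≠ j) (h' : k ≠ m) (he : edge i j h = edge k m h') :
    (i = k ∧ j = m) ∨ (i = m ∧ j = k) := by
  unfold edge at he
  split_ifs at he <;> simp only [Subtype.mk.injEq, Prod.mk.injEq] at he <;> tauto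

lemma int_single (sbm : SBM Ω ℙ n r) (ν : Fin r → Fin r → Measure ℝ)
    (hν : ∀ z i j, i ≠ j → (μ sbm z).map (sbm.X i j) = ν (z i) (z j))
    (f : ℝ → ℝ) (hf : Measurable f) (z : Fin n → Fin r) (i j : Fin n) (hij : i ≠ j) :
    ∫ ω, f (sbm.X i j ω) ∂(μ sbm z) = ∫ x, f x ∂(ν (z i) (z j)) := by
  rw [← hν z i j hij, integral_map (sbm.X_meas i j).aemeasurable hf.aestronglyMeasurable]

lemma int_three (sbm : SBM Ω ℙ n r) (hn : 4 ≤ n) (ν : Fin r → Fin r → Measure ℝ)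
    (hν : ∀ z i j, i ≠ j → (μ sbm z).map (sbm.X i j) = ν (z i) (z j))
    (f g h : ℝ → ℝ) (hf : Measurable f) (hg : Measurable g) (hh : Measurable h)
    (z : Fin n → Fin r) (i₁ i₂ i₃ i₄ : Fin n)
    (h12 : i₁ ≠ i₂) (h13 : i₁ ≠ i₃) (h14 : i₁ ≠ i₄)
    (h23 : i₂ ≠ i₃) (h34 : i₃ ≠ i₄) :
    ∫ ω, f (sbm.X i₁ i₂ ω) * g (sbm.X i₁ i₃ ω) * h (sbm.X i₃ i₄ ω) ∂(μ sbm z)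
      = (∫ x, f x ∂(ν (z i₁) (z i₂))) * (∫ x, g x ∂(ν (z i₁) (z i₃)))
          * (∫ x, h x ∂(ν (z i₃) (z i₄))) := by
  have hinj : Function.Injective ![edge i₁ i₂ h12, edge i₁ i₃ h13, edge i₃ i₄ h34] := by
    have n1 : edge i₁ i₂ h12 ≠ edge i₁ i₃ h13 := fun h => by
      have := edge_eq _ _ _ _ _ _ h; tauto
    have n2 : edge i₁ i₂ h12 ≠ edge i₃ i₄ h34 := fun h => by
      have := edge_eq _ _ _ _ _ _ h; tauto
    have n3 : edge i₁ i₃ h13 ≠ edge i₃ i₄ h34 := fun h => by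
      have := edge_eq _ _ _ _ _ _ h; tauto
    intro a b hab
    fin_cases a <;> fin_cases b <;> simp_all
  have hi := (indep sbm hn z).precomp hinj
  have key := hi.integral_fun_prod_comp (f := ![f, g, h])
    (fun i => (sbm.X_meas _ _).aemeasurable)
    (fun i => by fin_cases i <;> first
      | exact hf.aestronglyMeasurable
      | exact hg.aestronglyMeasurable
      | exact hh.aestronglyMeasurable)
  simp only [Fin.prod_univ_three, Matrix.cons_val_zero, Matrix.cons_val_one, Matrix.cons_val,
    X_edge] at key
  rw [key, int_single sbm ν hν f hf z _ _ h12, int_single sbm ν hν g hg z _ _ h13,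
    int_single sbm ν hν h hh z _ _ h34]

lemma setInt (sbm : SBM Ω ℙ n r) (z : Fin n → Fin r) (f : Ω → ℝ) :
    ∫ ω in A sbm z, f ω ∂ℙ = w sbm.p z * ∫ ω, f ω ∂(μ sbm z) := by
  have hw := w_pos sbm z
  rw [μ, ProbabilityTheory.cond, integral_smul_measure, P_A, ENNReal.toReal_inv,
    ENNReal.toReal_ofReal hw.le, smul_eq_mul, mul_inv_cancel_left₀ hw.ne']

lemma decomp (sbm : SBM Ω ℙ n r) (f : Ω → ℝ) (hf : Integrable f ℙ) (B : Set Ω)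
    (hB : MeasurableSet B) (Q : (Fin n → Fin r) → Prop) [DecidablePred Q]
    (hBQ : ∀ ω, ω ∈ B ↔ Q (fun i => sbm.Z i ω)) :
    ∫ ω in B, f ω ∂ℙ = ∑ z, w sbm.p z * ((if Q z then 1 else 0) * ∫ ω, f ω ∂(μ sbm z)) := by
  have hU : B = ⋃ z, (B ∩ A sbm z) := by
    ext ω
    simp only [Set.mem_iUnion, Set.mem_inter_iff]
    exact ⟨fun h => ⟨fun i => sbm.Z i ω, h, fun i => rfl⟩, fun ⟨_, h, _⟩ => h⟩
  conv_lhs => rw [hU]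
  rw [integral_iUnion_fintype]
  · refine Finset.sum_congr rfl fun z _ => ?_
    have hz : ∀ ω ∈ A sbm z, (fun i => sbm.Z i ω) = z := fun ω h => funext h
    split_ifs with hQ
    · have : B ∩ A sbm z = A sbm z := by
        apply Set.inter_eq_right.2
        intro ω h
        rw [hBQ, hz ω h]; exact hQ
      rw [this, setInt, one_mul]
    · have : B ∩ A sbm z = ∅ := by
        ext ω
        simp only [Set.mem_inter_iff, Set.mem_empty_iff_false, iff_false, not_and]
        intro h h'
        rw [hBQ, hz ω h'] at h; exact hQ h
      simp [this]
  · exact fun z => hB.inter (A_meas sbm z)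
  · intro z z' hzz
    rw [Function.onFun, Set.disjoint_left]
    rintro ω ⟨_, h⟩ ⟨_, h'⟩
    exact hzz (funext fun i => (h i).symm.trans (h' i))
  · exact fun z => hf.integrableOn

lemma marg (p : Fin r → ℝ) (hp : ∑ s, p s = 1) (i : Fin n) (h : (Fin n → Fin r) → ℝ) :
    ∑ z, w p z * h z = ∑ z, w p z * ∑ s, p s * h (Function.update z i s) := by
  classical
  let e := Equiv.funSplitAt i (Fin r)
  have hw : ∀ q, w p (e.symm q) = p q.1 * ∏ j, p (q.2 j) := by
    intro q
    rw [w, ← Finset.mul_prod_erase _ _ (Finset.mem_univ i)]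
    congr 1
    · simp [e, Equiv.funSplitAt, Equiv.piSplitAt]
    · rw [Finset.prod_subtype (p := fun j => j ≠ i) _ (by simp)]
      refine Finset.prod_congr rfl fun j _ => ?_
      simp [e, Equiv.funSplitAt, Equiv.piSplitAt, j.2]
  have hu : ∀ q s, Function.update (e.symm q) i s = e.symm (s, q.2) := by
    intro q s
    ext j
    by_cases hj : j = i
    · subst hj; simp [e, Equiv.funSplitAt, Equiv.piSplitAt]
    · simp [e, Equiv.funSplitAt, Equiv.piSplitAt, hj]
  rw [← e.symm.sum_comp, ← e.symm.sum_comp]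
  simp only [hw, hu]
  rw [Fintype.sum_prod_type, Fintype.sum_prod_type, Finset.sum_comm]
  simp only
  rw [Finset.sum_comm (f := fun a b => p a * _ * _)]
  refine Finset.sum_congr rfl fun y _ => ?_
  have : ∀ c d : ℝ, ∑ s, p s * c * d = c * d := fun c d => by
    rw [← Finset.sum_mul, ← Finset.sum_mul, hp, one_mul]
  rw [this, Finset.mul_sum]
  refine Finset.sum_congr rfl fun s _ => ?_
  ring

lemma w_sum (p : Fin r → ℝ) (hp : ∑ s, p s = 1) : ∑ z : Fin n → Fin r, w p z = 1 := by
  have := Finset.prod_univ_sum (fun _ : Fin n => (Finset.univ : Finset (Fin r))) (fun _ => p)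
  simp only [hp, Finset.prod_const_one, Fintype.piFinset_univ] at this
  exact this.symm

lemma marg2 (p : Fin r → ℝ) (hp : ∑ s, p s = 1) (i j : Fin n) (hij : i ≠ j)
    (h : Fin r → Fin r → ℝ) :
    ∑ z : Fin n → Fin r, w p z * h (z i) (z j) = ∑ s, p s * ∑ t, p t * h s t := by
  rw [marg p hp j, marg p hp i]
  simp only [Function.update_self, Function.update_of_ne hij]
  rw [← Finset.sum_mul, w_sum p hp, one_mul]

lemma marg4 (p : Fin r → ℝ) (hp : ∑ s, p s = 1) (i₁ i₂ i₃ i₄ : Fin n)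
    (h12 : i₁ ≠ i₂) (h13 : i₁ ≠ i₃) (h14 : i₁ ≠ i₄)
    (h23 : i₂ ≠ i₃) (h24 : i₂ ≠ i₄) (h34 : i₃ ≠ i₄)
    (h : Fin r → Fin r → Fin r → Fin r → ℝ) :
    ∑ z : Fin n → Fin r, w p z * h (z i₁) (z i₂) (z i₃) (z i₄)
      = ∑ s₁, p s₁ * ∑ s₂, p s₂ * ∑ s₃, p s₃ * ∑ s₄, p s₄ * h s₁ s₂ s₃ s₄ := by
  rw [marg p hp i₄]
  simp only [Function.update_self, Function.update_of_ne h14, Function.update_of_ne h24,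
    Function.update_of_ne h34]
  rw [marg p hp i₃]
  simp only [Function.update_self, Function.update_of_ne h13, Function.update_of_ne h23]
  rw [marg p hp i₂]
  simp only [Function.update_self, Function.update_of_ne h12]
  rw [marg p hp i₁]
  simp only [Function.update_self]
  rw [← Finset.sum_mul, w_sum p hp, one_mul]

lemma int_Z1 (sbm : SBM Ω ℙ n r) (ν : Fin r → Fin r → Measure ℝ)
    (hν : ∀ z i j, i ≠ j → (μ sbm z).map (sbm.X i j) = ν (z i) (z j))
    (f : ℝ → ℝ) (hf : Measurable f) (i j : Fin n) (hij : i ≠ j)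
    (hi : Integrable (fun ω => f (sbm.X i j ω)) ℙ) (s : Fin r) :
    ∫ ω in {ω | sbm.Z i ω = s}, f (sbm.X i j ω) ∂ℙ
      = sbm.p s * ∑ t, sbm.p t * ∫ x, f x ∂(ν s t) := by
  rw [decomp sbm _ hi {ω | sbm.Z i ω = s} (sbm.Z_meas i (measurableSet_singleton s))
    (fun z => z i = s) (fun ω => Iff.rfl)]
  simp only [int_single sbm ν hν f hf _ i j hij]
  rw [marg2 sbm.p sbm.p_sum i j hij (fun a b => (if a = s then 1 else 0) * ∫ x, f x ∂(ν a b))]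
  rw [Finset.sum_eq_single s]
  · simp
  · intro b _ hb; simp [hb]
  · simp

lemma int_Z2 (sbm : SBM Ω ℙ n r) (ν : Fin r → Fin r → Measure ℝ)
    (hν : ∀ z i j, i ≠ j → (μ sbm z).map (sbm.X i j) = ν (z i) (z j))
    (f : ℝ → ℝ) (hf : Measurable f) (i j : Fin n) (hij : i ≠ j)
    (hi : Integrable (fun ω => f (sbm.X i j ω)) ℙ) (s t : Fin r) :
    ∫ ω in {ω | sbm.Z i ω = s ∧ sbm.Z j ω = t}, f (sbm.X i j ω) ∂ℙ
      = sbm.p s * sbm.p t * ∫ x, f x ∂(ν s t) := by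
  rw [decomp sbm _ hi {ω | sbm.Z i ω = s ∧ sbm.Z j ω = t}
    ((sbm.Z_meas i (measurableSet_singleton s)).inter (sbm.Z_meas j (measurableSet_singleton t)))
    (fun z => z i = s ∧ z j = t) (fun ω => Iff.rfl)]
  simp only [int_single sbm ν hν f hf _ i j hij]
  rw [marg2 sbm.p sbm.p_sum i j hij
    (fun a b => (if a = s ∧ b = t then 1 else 0) * ∫ x, f x ∂(ν a b))]
  rw [Finset.sum_eq_single s]
  · rw [Finset.sum_eq_single t]
    · simp [mul_assoc]
    · intro b _ hb; simp [hb]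
    · simp
  · intro b _ hb; simp [hb]
  · simp

lemma ν_prob (sbm : SBM Ω ℙ n r) (hn : 4 ≤ n) (ν : Fin r → Fin r → Measure ℝ)
    (hν : ∀ z i j, i ≠ j → (μ sbm z).map (sbm.X i j) = ν (z i) (z j)) (s t : Fin r) :
    IsProbabilityMeasure (ν s t) := by
  let a : Fin n := ⟨0, by omega⟩
  let b : Fin n := ⟨1, by omega⟩
  have hab : a ≠ b := by simp [a, b]
  have h := hν (fun i => if i = a then s else t) a b hab
  simp only [if_true, if_neg hab.symm] at h
  rw [← h]
  have := μ_prob sbm (fun i => if i = a then s else t)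
  exact Measure.isProbabilityMeasure_map (sbm.X_meas a b).aemeasurable

lemma P_Z1 (sbm : SBM Ω ℙ n r) (hn : 4 ≤ n) (i j : Fin n) (hij : i ≠ j) (s : Fin r) :
    (ℙ {ω | sbm.Z i ω = s}).toReal = sbm.p s := by
  have := sbm.prob
  obtain ⟨ν, hν⟩ := exists_law sbm hn
  have hp := ν_prob sbm hn ν hν
  have h := int_Z1 sbm ν hν (fun _ => 1) measurable_const i j hij (integrable_const _) s
  simpa [sbm.p_sum, Measure.real] using h

lemma P_Z2 (sbm : SBM Ω ℙ n r) (hn : 4 ≤ n) (i j : Fin n) (hij : i ≠ j) (s t : Fin r) :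
    (ℙ {ω | sbm.Z i ω = s ∧ sbm.Z j ω = t}).toReal = sbm.p s * sbm.p t := by
  have := sbm.prob
  obtain ⟨ν, hν⟩ := exists_law sbm hn
  have hp := ν_prob sbm hn ν hν
  have h := int_Z2 sbm ν hν (fun _ => 1) measurable_const i j hij (integrable_const _) s t
  simpa [sbm.p_sum, Measure.real] using h

lemma int_path (sbm : SBM Ω ℙ n r) (hn : 4 ≤ n) (ν : Fin r → Fin r → Measure ℝ)
    (hν : ∀ z i j, i ≠ j → (μ sbm z).map (sbm.X i j) = ν (z i) (z j))
    (f g h : ℝ → ℝ) (hf : Measurable f) (hg : Measurable g) (hh : Measurable h)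
    (hfb : ∃ C, ∀ u, |f u| ≤ C) (hhb : ∃ C, ∀ u, |h u| ≤ C)
    (i₁ i₂ i₃ i₄ : Fin n)
    (h12 : i₁ ≠ i₂) (h13 : i₁ ≠ i₃) (h14 : i₁ ≠ i₄)
    (h23 : i₂ ≠ i₃) (h24 : i₂ ≠ i₄) (h34 : i₃ ≠ i₄)
    (hgi : Integrable (fun ω => g (sbm.X i₁ i₃ ω)) ℙ) :
    ∫ ω, f (sbm.X i₁ i₂ ω) * g (sbm.X i₁ i₃ ω) * h (sbm.X i₃ i₄ ω) ∂ℙ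
      = ∑ s, ∑ t, (∑ u, sbm.p u * ∫ x, f x ∂(ν s u))
          * (sbm.p s * sbm.p t * ∫ x, g x ∂(ν s t))
          * (∑ u, sbm.p u * ∫ x, h x ∂(ν t u)) := by
  have := sbm.prob
  obtain ⟨C, hC⟩ := hfb
  obtain ⟨D, hD⟩ := hhb
  have hint : Integrable
      (fun ω => f (sbm.X i₁ i₂ ω) * g (sbm.X i₁ i₃ ω) * h (sbm.X i₃ i₄ ω)) ℙ := by
    refine Integrable.mul_bdd (c := D) ?_ ?_ ?_
    · exact hgi.bdd_mul (c := C) (hf.comp (sbm.X_meas _ _)).aestronglyMeasurable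
        (Filter.Eventually.of_forall fun ω => hC _)
    · exact (hh.comp (sbm.X_meas _ _)).aestronglyMeasurable
    · exact Filter.Eventually.of_forall fun ω => hD _
  have hd := decomp sbm _ hint Set.univ MeasurableSet.univ (fun _ => True) (fun ω => by simp)
  rw [Measure.restrict_univ] at hd
  rw [hd]
  simp only [if_true, one_mul,
    int_three sbm hn ν hν f g h hf hg hh _ i₁ i₂ i₃ i₄ h12 h13 h14 h23 h34]
  rw [marg4 sbm.p sbm.p_sum i₁ i₂ i₃ i₄ h12 h13 h14 h23 h24 h34
    (fun a b c d => (∫ x, f x ∂(ν a b)) * (∫ x, g x ∂(ν a c)) * (∫ x, h x ∂(ν c d)))]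
  refine Finset.sum_congr rfl fun s _ => ?_
  simp only [Finset.mul_sum, Finset.sum_mul]
  rw [Finset.sum_comm]
  refine Finset.sum_congr rfl fun t _ => ?_
  rw [Finset.sum_comm]
  refine Finset.sum_congr rfl fun u _ => ?_
  refine Finset.sum_congr rfl fun v _ => ?_
  ring

lemma recover {l : ℕ} (G : Matrix (Fin l) (Fin r) ℝ) (hG : G.rank = r)
    (M : Matrix (Fin l) (Fin l) ℝ) (D : Matrix (Fin r) (Fin r) ℝ)
    (hM : M = G * D * G.transpose) :
    (G.transpose * G)⁻¹ * G.transpose * M * G * (G.transpose * G)⁻¹ = D := by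
  have hrk : (G.transpose * G).rank = r := by rw [Matrix.rank_transpose_mul_self, hG]
  have hu : IsUnit (G.transpose * G) := by
    have hs : Function.Surjective (G.transpose * G).mulVec := by
      have h : LinearMap.range (G.transpose * G).mulVecLin = ⊤ := by
        apply Submodule.eq_top_of_finrank_eq
        rw [← Matrix.rank, hrk]; simp
      exact LinearMap.range_eq_top.1 h
    exact Matrix.mulVec_surjective_iff_isUnit.1 hs
  have hdet := (Matrix.isUnit_iff_isUnit_det _).1 hu
  have : (G.transpose * G)⁻¹ * G.transpose * M * G * (G.transpose * G)⁻¹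
      = ((G.transpose * G)⁻¹ * (G.transpose * G)) * D
        * ((G.transpose * G) * (G.transpose * G)⁻¹) := by
    rw [hM]; simp only [Matrix.mul_assoc]
  rw [this, Matrix.nonsing_inv_mul _ hdet, Matrix.mul_nonsing_inv _ hdet, Matrix.one_mul,
    Matrix.mul_one]

end SBMaux

/-- closed-form recovery of the conditional expectations and community
proportions. Under the weighted stochastic block model, if the matrix `G` of conditional
expectations `(G) l' z = E(α_{l'}(X_{i,j}) | Z i = z)` has full column rank `r`, then,
with `M_φ` the path-graph moment matrix, `M₁` its version with `φ ≡ 1`, and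
`H_φ = (GᵀG)⁻¹ Gᵀ M_φ G (GᵀG)⁻¹`, `H₁ = (GᵀG)⁻¹ Gᵀ M₁ G (GᵀG)⁻¹`, one has
`(H₁) z₁ z₂ = p z₁ * p z₂ > 0`, `p z = √((H₁) z z)`, and
`E(φ(X_{i,j}) | Z i = z₁, Z j = z₂) = (H_φ) z₁ z₂ / (H₁) z₁ z₂`. -/
theorem closed_form_recovery
    {Ω : Type} [MeasurableSpace Ω] {ℙ : Measure Ω} {n r l : ℕ}
    (sbm : SBM Ω ℙ n r) (hn : 4 ≤ n)
    (α : Fin l → ℝ → ℝ)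
    (hα_meas : ∀ l', Measurable (α l'))
    (hα_bdd : ∀ l', ∃ C, ∀ u, |α l' u| ≤ C)
    (φ : ℝ → ℝ) (hφ_meas : Measurable φ)
    (hφ_int : ∀ i j, i ≠ j → Integrable (fun ω => φ (sbm.X i j ω)) ℙ)
    (G : Matrix (Fin l) (Fin r) ℝ)
    (hG : ∀ i j, i ≠ j → ∀ l' z,
      G l' z = (∫ ω in {ω | sbm.Z i ω = z}, α l' (sbm.X i j ω) ∂ℙ)
                  / (ℙ {ω | sbm.Z i ω = z}).toReal)
    (hGrank : G.rank = r)
    (i₁ i₂ i₃ i₄ : Fin n)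
    (h12 : i₁ ≠ i₂) (h13 : i₁ ≠ i₃) (h14 : i₁ ≠ i₄)
    (h23 : i₂ ≠ i₃) (h24 : i₂ ≠ i₄) (h34 : i₃ ≠ i₄)
    (Mφ M₁ : Matrix (Fin l) (Fin l) ℝ)
    (hMφ : ∀ l₁ l₂, Mφ l₁ l₂
      = ∫ ω, α l₁ (sbm.X i₁ i₂ ω) * φ (sbm.X i₁ i₃ ω) * α l₂ (sbm.X i₃ i₄ ω) ∂ℙ)
    (hM₁ : ∀ l₁ l₂, M₁ l₁ l₂
      = ∫ ω, α l₁ (sbm.X i₁ i₂ ω) * (1 : ℝ) * α l₂ (sbm.X i₃ i₄ ω) ∂ℙ)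
    (Hφ H₁ : Matrix (Fin r) (Fin r) ℝ)
    (hHφ : Hφ = (G.transpose * G)⁻¹ * G.transpose * Mφ * G * (G.transpose * G)⁻¹)
    (hH₁ : H₁ = (G.transpose * G)⁻¹ * G.transpose * M₁ * G * (G.transpose * G)⁻¹) :
    (∀ z₁ z₂, H₁ z₁ z₂ = sbm.p z₁ * sbm.p z₂ ∧ 0 < H₁ z₁ z₂) ∧
    (∀ z, sbm.p z = Real.sqrt (H₁ z z)) ∧
    (∀ i j, i ≠ j → ∀ z₁ z₂,
      (∫ ω in {ω | sbm.Z i ω = z₁ ∧ sbm.Z j ω = z₂}, φ (sbm.X i j ω) ∂ℙ)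
          / (ℙ {ω | sbm.Z i ω = z₁ ∧ sbm.Z j ω = z₂}).toReal
        = Hφ z₁ z₂ / H₁ z₁ z₂) := by
  have hprob := sbm.prob
  obtain ⟨ν, hν⟩ := SBMaux.exists_law sbm hn
  have hνp := SBMaux.ν_prob sbm hn ν hν
  have hαint : ∀ l' i j, Integrable (fun ω => α l' (sbm.X i j ω)) ℙ := by
    intro l' i j
    obtain ⟨C, hC⟩ := hα_bdd l'
    exact Integrable.of_bound ((hα_meas l').comp (sbm.X_meas i j)).aestronglyMeasurable C
      (Filter.Eventually.of_forall fun ω => hC _)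
  have hGf : ∀ l' z, G l' z = ∑ u, sbm.p u * ∫ x, α l' x ∂(ν z u) := by
    intro l' z
    rw [hG i₁ i₂ h12, SBMaux.P_Z1 sbm hn i₁ i₂ h12,
      SBMaux.int_Z1 sbm ν hν (α l') (hα_meas l') i₁ i₂ h12 (hαint _ _ _),
      mul_div_cancel_left₀ _ (sbm.p_pos z).ne']
  have hgen : ∀ (g : ℝ → ℝ), Measurable g → Integrable (fun ω => g (sbm.X i₁ i₃ ω)) ℙ →
      ∀ M : Matrix (Fin l) (Fin l) ℝ, (∀ l₁ l₂, M l₁ l₂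
        = ∫ ω, α l₁ (sbm.X i₁ i₂ ω) * g (sbm.X i₁ i₃ ω) * α l₂ (sbm.X i₃ i₄ ω) ∂ℙ) →
      (G.transpose * G)⁻¹ * G.transpose * M * G * (G.transpose * G)⁻¹
        = Matrix.of fun s t => sbm.p s * sbm.p t * ∫ x, g x ∂(ν s t) := by
    intro g hg hgi M hM
    apply SBMaux.recover G hGrank
    ext l₁ l₂
    rw [hM, SBMaux.int_path sbm hn ν hν (α l₁) g (α l₂) (hα_meas _) hg (hα_meas _)
      (hα_bdd _) (hα_bdd _) i₁ i₂ i₃ i₄ h12 h13 h14 h23 h24 h34 hgi]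
    simp only [Matrix.mul_apply, Matrix.transpose_apply, Matrix.of_apply, ← hGf,
      Finset.sum_mul]
    rw [Finset.sum_comm]
  have hφ' := hgen φ hφ_meas (hφ_int _ _ h13) Mφ hMφ
  have h1' := hgen (fun _ => 1) measurable_const (integrable_const _) M₁ hM₁
  rw [← hHφ] at hφ'
  rw [← hH₁] at h1'
  have h1 : ∀ z₁ z₂, H₁ z₁ z₂ = sbm.p z₁ * sbm.p z₂ := by
    intro z₁ z₂
    rw [h1']; simp
  refine ⟨fun z₁ z₂ => ⟨h1 z₁ z₂, ?_⟩, fun z => ?_, fun i j hij z₁ z₂ => ?_⟩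
  · rw [h1]; exact mul_pos (sbm.p_pos _) (sbm.p_pos _)
  · rw [h1, Real.sqrt_mul_self (sbm.p_pos z).le]
  · rw [h1, SBMaux.P_Z2 sbm hn i j hij,
      SBMaux.int_Z2 sbm ν hν φ hφ_meas i j hij (hφ_int i j hij), hφ']
    rfl
end

section
/- (Variance order of the smoothed fourth-order network average.) Under the weighted stochastic block model with n ≥ 8 nodes, bounded measurable functions α_{l_1}, α_{l_2} : ℝ → ℝ, a bounded kernel k : ℝ → ℝ, and conditional densities f_{z_1,z_2} uniformly bounded, let S_n := [n(n−1)(n−2)(n−3)]⁻¹ Σ_{i_1 ≠ i_2 ≠ i_3 ≠ i_4} α_{l_1}(X_{i_1,i_2}) h⁻¹ k((X_{i_2,i_3} − x)/h) α_{l_2}(X_{i_3,i_4}), the sum running over all ordered quadruples of distinct nodes. Then there is a constant C, independent of n and of h ∈ (0, 1], such that Var(S_n) ≤ C (n⁻¹ + (n² h)⁻¹). In particular, if n h → ∞ the variance of S_n is of order n⁻¹. -/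
open MeasureTheory

namespace SBMaux
open ProbabilityTheory

/-- unordered pairs encoded as increasing pairs -/
abbrev U (n : ℕ) := {q : Fin n × Fin n // q.1 < q.2}

/-- weight of a label configuration -/
noncomputable def wt {Ω : Type} [MeasurableSpace Ω] {P : Measure Ω} {n r : ℕ} (sbm : SBM Ω P n r)
    (z : Fin n → Fin r) : ℝ := ∏ i, sbm.p (z i)

/-- conditional measure given the labels -/
noncomputable def mz {Ω : Type} [MeasurableSpace Ω] {P : Measure Ω} {n r : ℕ} (sbm : SBM Ω P n r)
    (z : Fin n → Fin r) : Measure Ω := cond P ((fun ω i => sbm.Z i ω) ⁻¹' {z})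

/-- edge variable -/
def Y {Ω : Type} [MeasurableSpace Ω] {P : Measure Ω} {n r : ℕ} (sbm : SBM Ω P n r)
    (q : U n) : Ω → ℝ := sbm.X q.1.1 q.1.2

section basic
variable {Ω : Type} [MeasurableSpace Ω] {P : Measure Ω} {n r : ℕ} (sbm : SBM Ω P n r)

lemma Y_meas (q : U n) : Measurable (Y sbm q) := sbm.X_meas _ _

lemma wt_pos (z : Fin n → Fin r) : 0 < wt sbm z := Finset.prod_pos fun i _ => sbm.p_pos _

lemma wt_sum : ∑ z, wt sbm z = 1 := by
  unfold wt
  rw [← Fintype.piFinset_univ, ← Finset.prod_univ_sum]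
  simp [sbm.p_sum]

lemma Z_joint : Measurable (fun ω i => sbm.Z i ω) := measurable_pi_lambda _ sbm.Z_meas

lemma fiber_eq (z : Fin n → Fin r) :
    (fun ω i => sbm.Z i ω) ⁻¹' {z} = {ω | ∀ i, sbm.Z i ω = z i} := by
  ext ω; simp [funext_iff]

lemma prob_fiber (z : Fin n → Fin r) :
    P ((fun ω i => sbm.Z i ω) ⁻¹' {z}) = ENNReal.ofReal (wt sbm z) := by
  rw [fiber_eq, sbm.Z_iid]; rfl

lemma mz_prob (z : Fin n → Fin r) : IsProbabilityMeasure (mz sbm z) := by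
  have := sbm.prob
  apply cond_isProbabilityMeasure
  rw [prob_fiber]
  simpa using wt_pos sbm z

lemma decomp_s15 (g : Ω → ℝ) (hg : Measurable g) (c : ℝ) (hc : ∀ ω, |g ω| ≤ c) :
    ∫ ω, g ω ∂P = ∑ z, wt sbm z * ∫ ω, g ω ∂(mz sbm z) := by
  have := sbm.prob
  conv_lhs => rw [← sum_meas_smul_cond_fiber (Z_joint sbm) P]
  rw [integral_finsetSum_measure]
  · refine Finset.sum_congr rfl fun z _ => ?_
    rw [integral_smul_measure, prob_fiber, ENNReal.toReal_ofReal (wt_pos sbm z).le]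
    rfl
  · intro z _
    have := mz_prob sbm z
    refine Integrable.smul_measure ?_ (measure_ne_top _ _)
    exact Integrable.of_bound (μ := mz sbm z) hg.aestronglyMeasurable c (Filter.Eventually.of_forall hc)

lemma mz_rect (hF : ∀ a b x, 0 ≤ sbm.F a b x) (z : Fin n → Fin r) (S : Finset (U n)) (x : U n → ℝ) :
    mz sbm z (⋂ q ∈ S, Y sbm q ⁻¹' Set.Iic (x q))
      = ∏ q ∈ S, ENNReal.ofReal (sbm.F (z q.1.1) (z q.1.2) (x q)) := by
  have := sbm.prob
  unfold mz
  rw [cond_apply (Z_joint sbm (measurableSet_singleton z)), prob_fiber]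
  have h := sbm.X_cond z (S.map (Function.Embedding.subtype _)) (by
      intro q hq
      simp only [Finset.mem_map, Function.Embedding.subtype_apply] at hq
      obtain ⟨a, _, rfl⟩ := hq
      exact a.2) (fun q => if h : q.1 < q.2 then x ⟨q, h⟩ else 0)
  rw [Finset.prod_map, ENNReal.ofReal_mul (by
    apply Finset.prod_nonneg; intros; apply hF)] at h
  have e : ((fun ω i => sbm.Z i ω) ⁻¹' {z} ∩ ⋂ q ∈ S, Y sbm q ⁻¹' Set.Iic (x q))
      = {ω | ∀ q ∈ S.map (Function.Embedding.subtype _), sbm.X q.1 q.2 ω ≤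
          (fun q : Fin n × Fin n => if h : q.1 < q.2 then x ⟨q, h⟩ else 0) q}
          ∩ {ω | ∀ i, sbm.Z i ω = z i} := by
    rw [fiber_eq, Set.inter_comm]
    congr 1
    ext ω
    simp only [Set.mem_iInter, Set.mem_preimage, Set.mem_Iic, Finset.mem_map,
      Function.Embedding.subtype_apply, Set.mem_ofPred_eq, Y]
    constructor
    · rintro h q ⟨a, ha, rfl⟩
      simpa [a.2] using h a ha
    · intro h a ha
      simpa [a.2] using h a.1 ⟨a, ha, rfl⟩
  rw [e, h, mul_comm, mul_assoc]
  have h1 : ENNReal.ofReal (∏ i, sbm.p (z i)) * (ENNReal.ofReal (wt sbm z))⁻¹ = 1 := by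
    apply ENNReal.mul_inv_cancel
    · exact (by simpa using wt_pos sbm z : ENNReal.ofReal (wt sbm z) ≠ 0)
    · exact ENNReal.ofReal_ne_top
  rw [h1, mul_one, ENNReal.ofReal_prod_of_nonneg (fun _ _ => hF _ _ _)]
  refine Finset.prod_congr rfl fun q _ => ?_
  have := q.2
  simp [this]

lemma mz_Iic (hF : ∀ a b x, 0 ≤ sbm.F a b x) (z : Fin n → Fin r) (q : U n) (x : ℝ) :
    mz sbm z (Y sbm q ⁻¹' Set.Iic x) = ENNReal.ofReal (sbm.F (z q.1.1) (z q.1.2) x) := by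
  simpa using mz_rect sbm hF z {q} (fun _ => x)

lemma indep_s15 (hF : ∀ a b x, 0 ≤ sbm.F a b x) (z : Fin n → Fin r) :
    iIndepFun (Y sbm) (mz sbm z) := by
  have hgen : (inferInstance : MeasurableSpace ℝ) = MeasurableSpace.generateFrom (Set.range Set.Iic) := by
    rw [← borel_eq_generateFrom_Iic ℝ]; exact BorelSpace.measurable_eq
  refine iIndepSets.iIndep (fun q => (Y_meas sbm q).comap_le)
    (fun q => Set.preimage (Y sbm q) '' (Set.range Set.Iic)) ?_ ?_ ?_
  · intro q
    exact isPiSystem_Iic.comap (Y sbm q)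
  · intro q
    rw [← MeasurableSpace.comap_generateFrom, ← hgen]
  · rw [iIndepSets_iff]
    intro S g hg
    have : ∀ q : U n, ∃ x : ℝ, q ∈ S → g q = Y sbm q ⁻¹' Set.Iic x := by
      intro q
      by_cases hq : q ∈ S
      · obtain ⟨_, ⟨x, rfl⟩, h⟩ := hg q hq
        exact ⟨x, fun _ => h.symm⟩
      · exact ⟨0, fun h => absurd h hq⟩
    choose x hx using this
    have e1 : (⋂ i ∈ S, g i) = ⋂ i ∈ S, Y sbm i ⁻¹' Set.Iic (x i) :=
      Set.iInter₂_congr fun i hi => hx i hi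
    rw [e1, mz_rect sbm hF]
    refine Finset.prod_congr rfl fun q hq => ?_
    rw [hx q hq, mz_Iic sbm hF]

lemma law (f : Fin r → Fin r → ℝ → ℝ)
    (hf : ∀ z₁ z₂ x, sbm.F z₁ z₂ x = ∫ u in Set.Iic x, f z₁ z₂ u)
    (hm : ∀ z₁ z₂, Measurable (f z₁ z₂)) (h0 : ∀ z₁ z₂ u, 0 ≤ f z₁ z₂ u) (Cf : ℝ)
    (hC : ∀ z₁ z₂ u, f z₁ z₂ u ≤ Cf) (z : Fin n → Fin r) (q : U n) :
    (mz sbm z).map (Y sbm q) =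
      volume.withDensity (fun u => ENNReal.ofReal (f (z q.1.1) (z q.1.2) u)) := by
  have := mz_prob sbm z
  have hF : ∀ a b x, 0 ≤ sbm.F a b x := fun a b x => by
    rw [hf]; exact integral_nonneg (h0 a b)
  have hI : ∀ y, (mz sbm z).map (Y sbm q) (Set.Iic y)
      = ENNReal.ofReal (sbm.F (z q.1.1) (z q.1.2) y) := fun y => by
    rw [Measure.map_apply (Y_meas sbm q) measurableSet_Iic, mz_Iic sbm hF]
  have : IsProbabilityMeasure ((mz sbm z).map (Y sbm q)) :=
    Measure.isProbabilityMeasure_map (Y_meas sbm q).aemeasurable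
  set g := f (z q.1.1) (z q.1.2) with hg
  have hex : ∃ y, IntegrableOn g (Set.Iic y) := by
    by_contra hcon
    push Not at hcon
    have h1 := tendsto_measure_Iic_atTop ((mz sbm z).map (Y sbm q))
    have h2 : ∀ y, (mz sbm z).map (Y sbm q) (Set.Iic y) = 0 := by
      intro y
      rw [hI, hf, integral_undef (hcon y), ENNReal.ofReal_zero]
    simp only [h2] at h1
    have := tendsto_nhds_unique h1 tendsto_const_nhds
    simp at this
  obtain ⟨y, hy⟩ := hex
  have hall : ∀ x, IntegrableOn g (Set.Iic x) := by
    intro x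
    have hb : IntegrableOn g (Set.Icc y x) := by
      refine Measure.integrableOn_of_bounded (M := Cf) (by simp) (hm _ _).aestronglyMeasurable ?_
      refine Filter.Eventually.of_forall fun u => ?_
      rw [Real.norm_eq_abs, abs_of_nonneg (h0 _ _ u)]
      exact hC _ _ u
    refine (hy.union hb).mono_set ?_
    intro u hu
    rcases le_total u y with h | h
    · exact Or.inl h
    · exact Or.inr ⟨h, hu⟩
  apply Measure.ext_of_Iic
  intro x
  rw [hI, hf, withDensity_apply _ measurableSet_Iic,
    ofReal_integral_eq_lintegral_ofReal (hall x) (Filter.Eventually.of_forall (h0 _ _))]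

/-- expectation of a nonnegative function of an edge -/
lemma edge_bound (f : Fin r → Fin r → ℝ → ℝ)
    (hf : ∀ z₁ z₂ x, sbm.F z₁ z₂ x = ∫ u in Set.Iic x, f z₁ z₂ u)
    (hm : ∀ z₁ z₂, Measurable (f z₁ z₂)) (h0 : ∀ z₁ z₂ u, 0 ≤ f z₁ z₂ u) (Cf : ℝ)
    (hC : ∀ z₁ z₂ u, f z₁ z₂ u ≤ Cf) (z : Fin n → Fin r) (q : U n)
    (g : ℝ → ℝ) (hgm : Measurable g) (hg0 : ∀ u, 0 ≤ g u) (hgi : Integrable g) :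
    ∫ ω, g (Y sbm q ω) ∂(mz sbm z) ≤ Cf * ∫ u, g u := by
  rw [← integral_map (Y_meas sbm q).aemeasurable hgm.aestronglyMeasurable,
    law sbm f hf hm h0 Cf hC, integral_withDensity_eq_integral_toReal_smul
      (by have := hm (z q.1.1) (z q.1.2); fun_prop) (by simp), ← integral_const_mul]
  apply integral_mono_of_nonneg
  · exact Filter.Eventually.of_forall fun u => by
      simp only [smul_eq_mul, Pi.zero_apply]; have := hg0 u; positivity
  · exact hgi.const_mul _
  · refine Filter.Eventually.of_forall fun u => ?_
    simp only [smul_eq_mul]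
    rw [ENNReal.toReal_ofReal (h0 _ _ _)]
    exact mul_le_mul_of_nonneg_right (hC _ _ _) (hg0 u)

lemma edge_congr (f : Fin r → Fin r → ℝ → ℝ)
    (hf : ∀ z₁ z₂ x, sbm.F z₁ z₂ x = ∫ u in Set.Iic x, f z₁ z₂ u)
    (hm : ∀ z₁ z₂, Measurable (f z₁ z₂)) (h0 : ∀ z₁ z₂ u, 0 ≤ f z₁ z₂ u) (Cf : ℝ)
    (hC : ∀ z₁ z₂ u, f z₁ z₂ u ≤ Cf) (z z' : Fin n → Fin r) (q : U n)
    (h1 : z q.1.1 = z' q.1.1) (h2 : z q.1.2 = z' q.1.2)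
    (g : ℝ → ℝ) (hgm : Measurable g) :
    ∫ ω, g (Y sbm q ω) ∂(mz sbm z) = ∫ ω, g (Y sbm q ω) ∂(mz sbm z') := by
  rw [← integral_map (Y_meas sbm q).aemeasurable hgm.aestronglyMeasurable,
    ← integral_map (Y_meas sbm q).aemeasurable hgm.aestronglyMeasurable,
    law sbm f hf hm h0 Cf hC, law sbm f hf hm h0 Cf hC, h1, h2]

/-- swap lemma -/
lemma swap_sum (B : Finset (Fin n)) (G H : (Fin n → Fin r) → ℝ)
    (hG : ∀ z z', (∀ i, i ∉ B → z i = z' i) → G z = G z')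
    (hH : ∀ z z', (∀ i ∈ B, z i = z' i) → H z = H z') :
    ∑ z, wt sbm z * (G z * H z) = (∑ z, wt sbm z * G z) * (∑ z, wt sbm z * H z) := by
  let sw : (Fin n → Fin r) × (Fin n → Fin r) → (Fin n → Fin r) × (Fin n → Fin r) :=
    fun w => (fun i => if i ∈ B then w.2 i else w.1 i, fun i => if i ∈ B then w.1 i else w.2 i)
  have hsw : Function.Involutive sw := by
    intro w
    ext i <;> simp only [sw] <;> split_ifs <;> rfl
  have hw : ∀ w, wt sbm (sw w).1 * wt sbm (sw w).2 = wt sbm w.1 * wt sbm w.2 := by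
    intro w
    unfold wt
    rw [← Finset.prod_mul_distrib, ← Finset.prod_mul_distrib]
    refine Finset.prod_congr rfl fun i _ => ?_
    simp only [sw]
    split_ifs
    · ring
    · rfl
  calc ∑ z, wt sbm z * (G z * H z)
      = (∑ z, wt sbm z * (G z * H z)) * ∑ z, wt sbm z := by rw [wt_sum, mul_one]
    _ = ∑ w : (Fin n → Fin r) × (Fin n → Fin r),
          (wt sbm w.1 * wt sbm w.2) * (G w.1 * H w.1) := by
        rw [Finset.sum_mul_sum, Fintype.sum_prod_type]
        refine Finset.sum_congr rfl fun _ _ => Finset.sum_congr rfl fun _ _ => ?_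
        ring
    _ = ∑ w : (Fin n → Fin r) × (Fin n → Fin r),
          (wt sbm w.1 * wt sbm w.2) * (G w.1 * H w.2) := by
        rw [← Equiv.sum_comp hsw.toPerm]
        refine Finset.sum_congr rfl fun w _ => ?_
        simp only [Function.Involutive.coe_toPerm]
        rw [hw, hG (sw w).1 w.1 (fun i hi => by simp [sw, hi]),
          hH (sw w).1 w.2 (fun i hi => by simp [sw, hi])]
    _ = _ := by
        rw [Finset.sum_mul_sum, Fintype.sum_prod_type]
        refine Finset.sum_congr rfl fun _ _ => Finset.sum_congr rfl fun _ _ => ?_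
        ring

end basic

/-- the summand -/
def T {Ω : Type} [MeasurableSpace Ω] {P : Measure Ω} {n r : ℕ} (sbm : SBM Ω P n r)
    (α₁ K α₂ : ℝ → ℝ) (a b c : U n) : Ω → ℝ :=
  fun ω => α₁ (Y sbm a ω) * K (Y sbm b ω) * α₂ (Y sbm c ω)

section covs
variable {Ω : Type} [MeasurableSpace Ω] {P : Measure Ω} {n r : ℕ} (sbm : SBM Ω P n r)

lemma T_meas {α₁ K α₂ : ℝ → ℝ} (h1 : Measurable α₁) (hK : Measurable K) (h2 : Measurable α₂)
    (a b c : U n) : Measurable (T sbm α₁ K α₂ a b c) :=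
  ((h1.comp (Y_meas sbm a)).mul (hK.comp (Y_meas sbm b))).mul (h2.comp (Y_meas sbm c))

lemma T_le {α₁ K α₂ : ℝ → ℝ} {C : ℝ} (b1 : ∀ u, |α₁ u| ≤ C) (b2 : ∀ u, |α₂ u| ≤ C)
    (a b c : U n) (ω : Ω) : |T sbm α₁ K α₂ a b c ω| ≤ C ^ 2 * |K (Y sbm b ω)| := by
  unfold T
  rw [abs_mul, abs_mul]
  have hC : 0 ≤ C := (abs_nonneg _).trans (b1 0)
  calc _ ≤ C * |K (Y sbm b ω)| * C := by
        gcongr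
        · exact b1 _
        · exact b2 _
    _ = _ := by ring

lemma abs_decomp (g : Ω → ℝ) (hg : Measurable g) (c : ℝ) (hc : ∀ ω, |g ω| ≤ c) (m : ℝ)
    (hm : ∀ z, ∫ ω, |g ω| ∂(mz sbm z) ≤ m) : |∫ ω, g ω ∂P| ≤ m := by
  rw [decomp_s15 sbm g hg c hc]
  calc _ ≤ ∑ z, |wt sbm z * ∫ ω, g ω ∂(mz sbm z)| := Finset.abs_sum_le_sum_abs _ _
    _ ≤ ∑ z, wt sbm z * m := by
        refine Finset.sum_le_sum fun z _ => ?_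
        rw [abs_mul, abs_of_pos (wt_pos sbm z)]
        exact mul_le_mul_of_nonneg_left ((abs_integral_le_integral_abs).trans (hm z))
          (wt_pos sbm z).le
    _ = m := by rw [← Finset.sum_mul, wt_sum, one_mul]

variable {α₁ K α₂ : ℝ → ℝ} {C M m1 m2 : ℝ}

lemma T_memLp (h1 : Measurable α₁) (hK : Measurable K) (h2 : Measurable α₂)
    (b1 : ∀ u, |α₁ u| ≤ C) (b2 : ∀ u, |α₂ u| ≤ C) (bK : ∀ u, |K u| ≤ M) (a b c : U n) :
    MemLp (T sbm α₁ K α₂ a b c) 2 P := by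
  have := sbm.prob
  refine MemLp.of_bound (T_meas sbm h1 hK h2 a b c).aestronglyMeasurable (C ^ 2 * M)
    (Filter.Eventually.of_forall fun ω => ?_)
  exact (T_le sbm b1 b2 a b c ω).trans (mul_le_mul_of_nonneg_left (bK _) (sq_nonneg C))

lemma T_mean (h1 : Measurable α₁) (hK : Measurable K) (h2 : Measurable α₂)
    (b1 : ∀ u, |α₁ u| ≤ C) (b2 : ∀ u, |α₂ u| ≤ C) (bK : ∀ u, |K u| ≤ M)
    (hm1 : ∀ z q, ∫ ω, |K (Y sbm q ω)| ∂(mz sbm z) ≤ m1) (a b c : U n) :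
    |∫ ω, T sbm α₁ K α₂ a b c ω ∂P| ≤ C ^ 2 * m1 := by
  refine abs_decomp sbm _ (T_meas sbm h1 hK h2 a b c) (C ^ 2 * M) (fun ω =>
    (T_le sbm b1 b2 a b c ω).trans (mul_le_mul_of_nonneg_left (bK _) (sq_nonneg C))) _ ?_
  intro z
  have := mz_prob sbm z
  calc _ ≤ ∫ ω, C ^ 2 * |K (Y sbm b ω)| ∂(mz sbm z) := by
        apply integral_mono_of_nonneg
        · exact Filter.Eventually.of_forall fun _ => abs_nonneg _
        · refine Integrable.const_mul ?_ _
          exact Integrable.of_bound (hK.comp (Y_meas sbm b)).abs.aestronglyMeasurable M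
            (Filter.Eventually.of_forall fun ω => by simpa using bK _)
        · exact Filter.Eventually.of_forall fun ω => T_le sbm b1 b2 a b c ω
    _ ≤ _ := by
        rw [integral_const_mul]
        exact mul_le_mul_of_nonneg_left (hm1 z b) (sq_nonneg C)

/-- generic covariance bound from a bound on the product of kernels -/
lemma cov_gen (h1 : Measurable α₁) (hK : Measurable K) (h2 : Measurable α₂)
    (b1 : ∀ u, |α₁ u| ≤ C) (b2 : ∀ u, |α₂ u| ≤ C) (bK : ∀ u, |K u| ≤ M)
    (hm1 : ∀ z q, ∫ ω, |K (Y sbm q ω)| ∂(mz sbm z) ≤ m1) (a b c a' b' c' : U n) (s : ℝ)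
    (hs : ∀ z, ∫ ω, |K (Y sbm b ω)| * |K (Y sbm b' ω)| ∂(mz sbm z) ≤ s) :
    covariance (T sbm α₁ K α₂ a b c) (T sbm α₁ K α₂ a' b' c') P ≤ C ^ 4 * s + (C ^ 2 * m1) ^ 2 := by
  have := sbm.prob
  have hM : 0 ≤ M := (abs_nonneg _).trans (bK 0)
  rw [covariance_eq_sub (T_memLp sbm h1 hK h2 b1 b2 bK a b c)
    (T_memLp sbm h1 hK h2 b1 b2 bK a' b' c')]
  have hp : ∀ ω, |(T sbm α₁ K α₂ a b c * T sbm α₁ K α₂ a' b' c') ω|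
      ≤ C ^ 4 * (|K (Y sbm b ω)| * |K (Y sbm b' ω)|) := by
    intro ω
    rw [Pi.mul_apply, abs_mul]
    calc _ ≤ (C ^ 2 * |K (Y sbm b ω)|) * (C ^ 2 * |K (Y sbm b' ω)|) := by
          gcongr
          · exact T_le sbm b1 b2 a b c ω
          · exact T_le sbm b1 b2 a' b' c' ω
      _ = _ := by ring
  have hkk : ∀ ω, |K (Y sbm b ω)| * |K (Y sbm b' ω)| ≤ M * M := fun ω => by
    gcongr
    · exact bK _
    · exact bK _
  have e1 : |∫ ω, (T sbm α₁ K α₂ a b c * T sbm α₁ K α₂ a' b' c') ω ∂P| ≤ C ^ 4 * s := by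
    refine abs_decomp sbm _ ((T_meas sbm h1 hK h2 a b c).mul (T_meas sbm h1 hK h2 a' b' c'))
      (C ^ 4 * (M * M)) (fun ω => (hp ω).trans ?_) _ ?_
    · exact mul_le_mul_of_nonneg_left (hkk ω) (by positivity)
    intro z
    have := mz_prob sbm z
    calc _ ≤ ∫ ω, C ^ 4 * (|K (Y sbm b ω)| * |K (Y sbm b' ω)|) ∂(mz sbm z) := by
          apply integral_mono_of_nonneg
          · exact Filter.Eventually.of_forall fun _ => abs_nonneg _
          · refine Integrable.const_mul ?_ _
            refine Integrable.of_bound ((hK.comp (Y_meas sbm b)).abs.mul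
              (hK.comp (Y_meas sbm b')).abs).aestronglyMeasurable (M * M)
              (Filter.Eventually.of_forall fun ω => by simpa using hkk ω)
          · exact Filter.Eventually.of_forall fun ω => hp ω
      _ ≤ _ := by
          rw [integral_const_mul]
          exact mul_le_mul_of_nonneg_left (hs z) (by positivity)
  have e2 := T_mean sbm h1 hK h2 b1 b2 bK hm1 a b c
  have e3 := T_mean sbm h1 hK h2 b1 b2 bK hm1 a' b' c'
  have e4 : |(∫ ω, T sbm α₁ K α₂ a b c ω ∂P) * ∫ ω, T sbm α₁ K α₂ a' b' c' ω ∂P|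
      ≤ (C ^ 2 * m1) ^ 2 := by
    rw [abs_mul, sq]
    exact mul_le_mul e2 e3 (abs_nonneg _) ((abs_nonneg _).trans e2)
  have := abs_le.1 e1
  have := abs_le.1 e4
  linarith

lemma cov_ne (hF : ∀ a b x, 0 ≤ sbm.F a b x)
    (h1 : Measurable α₁) (hK : Measurable K) (h2 : Measurable α₂)
    (b1 : ∀ u, |α₁ u| ≤ C) (b2 : ∀ u, |α₂ u| ≤ C) (bK : ∀ u, |K u| ≤ M)
    (hm1 : ∀ z q, ∫ ω, |K (Y sbm q ω)| ∂(mz sbm z) ≤ m1) (a b c a' b' c' : U n)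
    (hb : b ≠ b') :
    covariance (T sbm α₁ K α₂ a b c) (T sbm α₁ K α₂ a' b' c') P ≤ 2 * (C ^ 2 * m1) ^ 2 := by
  refine (cov_gen sbm h1 hK h2 b1 b2 bK hm1 a b c a' b' c' (m1 * m1) ?_).trans_eq (by ring)
  intro z
  have hi : IndepFun (fun ω => |K (Y sbm b ω)|) (fun ω => |K (Y sbm b' ω)|) (mz sbm z) :=
    ((indep_s15 sbm hF z).indepFun hb).comp (φ := fun u => |K u|) (ψ := fun u => |K u|) hK.abs hK.abs
  rw [hi.integral_fun_mul_eq_mul_integral (hK.comp (Y_meas sbm b)).abs.aestronglyMeasurable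
    (hK.comp (Y_meas sbm b')).abs.aestronglyMeasurable]
  have h0 : 0 ≤ ∫ ω, |K (Y sbm b ω)| ∂(mz sbm z) := integral_nonneg fun _ => abs_nonneg _
  have h0' : 0 ≤ ∫ ω, |K (Y sbm b' ω)| ∂(mz sbm z) := integral_nonneg fun _ => abs_nonneg _
  exact mul_le_mul (hm1 z b) (hm1 z b') h0' (h0.trans (hm1 z b))

lemma cov_eq (h1 : Measurable α₁) (hK : Measurable K) (h2 : Measurable α₂)
    (b1 : ∀ u, |α₁ u| ≤ C) (b2 : ∀ u, |α₂ u| ≤ C) (bK : ∀ u, |K u| ≤ M)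
    (hm1 : ∀ z q, ∫ ω, |K (Y sbm q ω)| ∂(mz sbm z) ≤ m1)
    (hm2 : ∀ z q, ∫ ω, |K (Y sbm q ω)| * |K (Y sbm q ω)| ∂(mz sbm z) ≤ m2)
    (a b c a' c' : U n) :
    covariance (T sbm α₁ K α₂ a b c) (T sbm α₁ K α₂ a' b c') P
      ≤ C ^ 4 * m2 + (C ^ 2 * m1) ^ 2 :=
  cov_gen sbm h1 hK h2 b1 b2 bK hm1 a b c a' b c' m2 (fun z => hm2 z b)

lemma T_prod (hF : ∀ a b x, 0 ≤ sbm.F a b x)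
    (h1 : Measurable α₁) (hK : Measurable K) (h2 : Measurable α₂) (z : Fin n → Fin r)
    (a b c : U n) (hab : a ≠ b) (hac : a ≠ c) (hbc : b ≠ c) :
    ∫ ω, T sbm α₁ K α₂ a b c ω ∂(mz sbm z) = (∫ ω, α₁ (Y sbm a ω) ∂(mz sbm z)) *
      (∫ ω, K (Y sbm b ω) ∂(mz sbm z)) * (∫ ω, α₂ (Y sbm c ω) ∂(mz sbm z)) := by
  have hi := indep_s15 sbm hF z
  have i1 : IndepFun (fun ω => α₁ (Y sbm a ω)) (fun ω => K (Y sbm b ω)) (mz sbm z) :=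
    (hi.indepFun hab).comp h1 hK
  have i2 : IndepFun (fun ω => α₁ (Y sbm a ω) * K (Y sbm b ω)) (fun ω => α₂ (Y sbm c ω))
      (mz sbm z) :=
    (hi.indepFun_prodMk (Y_meas sbm) a b c hac hbc).comp
      (φ := fun p : ℝ × ℝ => α₁ p.1 * K p.2) (ψ := α₂)
      ((h1.comp measurable_fst).mul (hK.comp measurable_snd)) h2
  unfold T
  rw [i2.integral_fun_mul_eq_mul_integral
    ((h1.comp (Y_meas sbm a)).mul (hK.comp (Y_meas sbm b))).aestronglyMeasurable
    (h2.comp (Y_meas sbm c)).aestronglyMeasurable,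
    i1.integral_fun_mul_eq_mul_integral
    (h1.comp (Y_meas sbm a)).aestronglyMeasurable (hK.comp (Y_meas sbm b)).aestronglyMeasurable]

lemma cov_disj (f : Fin r → Fin r → ℝ → ℝ)
    (hf : ∀ z₁ z₂ x, sbm.F z₁ z₂ x = ∫ u in Set.Iic x, f z₁ z₂ u)
    (hm : ∀ z₁ z₂, Measurable (f z₁ z₂)) (h0 : ∀ z₁ z₂ u, 0 ≤ f z₁ z₂ u) (Cf : ℝ)
    (hC : ∀ z₁ z₂ u, f z₁ z₂ u ≤ Cf)
    (h1 : Measurable α₁) (hK : Measurable K) (h2 : Measurable α₂)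
    (b1 : ∀ u, |α₁ u| ≤ C) (b2 : ∀ u, |α₂ u| ≤ C) (bK : ∀ u, |K u| ≤ M)
    (a b c a' b' c' : U n) (hab : a ≠ b) (hac : a ≠ c) (hbc : b ≠ c)
    (hab' : a' ≠ b') (hac' : a' ≠ c') (hbc' : b' ≠ c') (B : Finset (Fin n))
    (hI : ∀ q ∈ ({a, b, c} : Finset (U n)), q.1.1 ∉ B ∧ q.1.2 ∉ B)
    (hJ : ∀ q ∈ ({a', b', c'} : Finset (U n)), q.1.1 ∈ B ∧ q.1.2 ∈ B) :
    covariance (T sbm α₁ K α₂ a b c) (T sbm α₁ K α₂ a' b' c') P = 0 := by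
  have := sbm.prob
  have hF : ∀ a b x, 0 ≤ sbm.F a b x := fun a b x => by
    rw [hf]; exact integral_nonneg (h0 a b)
  have hM : 0 ≤ M := (abs_nonneg _).trans (bK 0)
  have hT : ∀ a b c ω, |T sbm α₁ K α₂ a b c ω| ≤ C ^ 2 * M := fun a b c ω =>
    (T_le sbm b1 b2 a b c ω).trans (mul_le_mul_of_nonneg_left (bK _) (sq_nonneg C))
  rw [covariance_eq_sub (T_memLp sbm h1 hK h2 b1 b2 bK a b c)
    (T_memLp sbm h1 hK h2 b1 b2 bK a' b' c'),
    decomp_s15 sbm _ (T_meas sbm h1 hK h2 a b c) _ (hT a b c),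
    decomp_s15 sbm _ (T_meas sbm h1 hK h2 a' b' c') _ (hT a' b' c'),
    decomp_s15 sbm _ ((T_meas sbm h1 hK h2 a b c).mul (T_meas sbm h1 hK h2 a' b' c'))
      ((C ^ 2 * M) * (C ^ 2 * M)) (fun ω => by
        rw [Pi.mul_apply, abs_mul]
        exact mul_le_mul (hT _ _ _ _) (hT _ _ _ _) (abs_nonneg _) (by positivity)),
    ← swap_sum sbm B, sub_eq_zero]
  · refine Finset.sum_congr rfl fun z _ => ?_
    congr 1
    have hd : Disjoint ({a, b, c} : Finset (U n)) {a', b', c'} := by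
      rw [Finset.disjoint_left]
      intro q hq hq'
      exact (hI q hq).1 (hJ q hq').1
    have hi := (indep_s15 sbm hF z).indepFun_finset _ _ hd (Y_meas sbm)
    have hi' : IndepFun (T sbm α₁ K α₂ a b c) (T sbm α₁ K α₂ a' b' c') (mz sbm z) := by
      refine hi.comp
        (φ := fun v => α₁ (v ⟨a, by simp⟩) * K (v ⟨b, by simp⟩) * α₂ (v ⟨c, by simp⟩))
        (ψ := fun v => α₁ (v ⟨a', by simp⟩) * K (v ⟨b', by simp⟩) * α₂ (v ⟨c', by simp⟩)) ?_ ?_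
      · fun_prop
      · fun_prop
    exact hi'.integral_mul_eq_mul_integral (T_meas sbm h1 hK h2 a b c).aestronglyMeasurable
      (T_meas sbm h1 hK h2 a' b' c').aestronglyMeasurable
  · intro z z' hz
    rw [T_prod sbm hF h1 hK h2 z a b c hab hac hbc, T_prod sbm hF h1 hK h2 z' a b c hab hac hbc]
    have key : ∀ q ∈ ({a, b, c} : Finset (U n)), ∀ g : ℝ → ℝ, Measurable g →
        ∫ ω, g (Y sbm q ω) ∂(mz sbm z) = ∫ ω, g (Y sbm q ω) ∂(mz sbm z') := fun q hq g hg =>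
      edge_congr sbm f hf hm h0 Cf hC z z' q (hz _ (hI q hq).1) (hz _ (hI q hq).2) g hg
    rw [key a (by simp) _ h1, key b (by simp) _ hK, key c (by simp) _ h2]
  · intro z z' hz
    rw [T_prod sbm hF h1 hK h2 z a' b' c' hab' hac' hbc',
      T_prod sbm hF h1 hK h2 z' a' b' c' hab' hac' hbc']
    have key : ∀ q ∈ ({a', b', c'} : Finset (U n)), ∀ g : ℝ → ℝ, Measurable g →
        ∫ ω, g (Y sbm q ω) ∂(mz sbm z) = ∫ ω, g (Y sbm q ω) ∂(mz sbm z') := fun q hq g hg =>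
      edge_congr sbm f hf hm h0 Cf hC z z' q (hz _ (hJ q hq).1) (hz _ (hJ q hq).2) g hg
    rw [key a' (by simp) _ h1, key b' (by simp) _ hK, key c' (by simp) _ h2]

end covs

/-- indicator of equality -/
def ind {n : ℕ} (i j : Fin n) : ℝ := if i = j then 1 else 0

lemma ind_nonneg {n : ℕ} (i j : Fin n) : 0 ≤ ind i j := by unfold ind; split_ifs <;> norm_num

/-- quadruples of nodes -/
abbrev Q (n : ℕ) := Fin n × Fin n × Fin n × Fin n

/-- number of coincidences of a node with a quadruple -/
def s4 {n : ℕ} (i : Fin n) (J : Q n) : ℝ :=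
  ind i J.1 + ind i J.2.1 + ind i J.2.2.1 + ind i J.2.2.2

/-- number of coincidences of two quadruples -/
def share {n : ℕ} (I J : Q n) : ℝ := s4 I.1 J + s4 I.2.1 J + s4 I.2.2.1 J + s4 I.2.2.2 J

/-- coincidence of middle edges -/
def mid {n : ℕ} (I J : Q n) : ℝ :=
  ind I.2.1 J.2.1 * ind I.2.2.1 J.2.2.1 + ind I.2.1 J.2.2.1 * ind I.2.2.1 J.2.1

lemma ind_sum {n : ℕ} (i : Fin n) : ∑ j, ind i j = 1 := by simp [ind]

lemma s4_sum {n : ℕ} (i : Fin n) : ∑ J : Q n, s4 i J = 4 * (n : ℝ) ^ 3 := by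
  simp only [s4, Fintype.sum_prod_type, Finset.sum_add_distrib, Finset.sum_const,
    Finset.card_univ, Fintype.card_fin, Fintype.card_prod, Nat.cast_mul, nsmul_eq_mul, ← Finset.mul_sum, ind_sum]
  ring

lemma share_sum {n : ℕ} : ∑ I : Q n, ∑ J : Q n, share I J = 16 * (n : ℝ) ^ 7 := by
  simp only [share, Finset.sum_add_distrib, s4_sum]
  simp
  ring

lemma mid_sum {n : ℕ} : ∑ I : Q n, ∑ J : Q n, mid I J = 2 * (n : ℝ) ^ 6 := by
  have h : ∀ I : Q n, ∑ J : Q n, mid I J = 2 * (n : ℝ) ^ 2 := by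
    intro I
    simp only [mid, Fintype.sum_prod_type, Finset.sum_add_distrib, Finset.sum_const,
      Finset.card_univ, Fintype.card_fin, Fintype.card_prod, Nat.cast_mul, nsmul_eq_mul, ← Finset.mul_sum, ← Finset.sum_mul,
      ind_sum]
    ring
  simp only [h]
  simp
  ring

lemma s4_nonneg {n : ℕ} (i : Fin n) (J : Q n) : 0 ≤ s4 i J := by
  unfold s4
  have := ind_nonneg i J.1
  have := ind_nonneg i J.2.1
  have := ind_nonneg i J.2.2.1
  have := ind_nonneg i J.2.2.2
  linarith

lemma share_nonneg {n : ℕ} (I J : Q n) : 0 ≤ share I J := by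
  unfold share
  have := s4_nonneg I.1 J
  have := s4_nonneg I.2.1 J
  have := s4_nonneg I.2.2.1 J
  have := s4_nonneg I.2.2.2 J
  linarith

lemma mid_nonneg {n : ℕ} (I J : Q n) : 0 ≤ mid I J := by
  unfold mid
  have := mul_nonneg (ind_nonneg I.2.1 J.2.1) (ind_nonneg I.2.2.1 J.2.2.1)
  have := mul_nonneg (ind_nonneg I.2.1 J.2.2.1) (ind_nonneg I.2.2.1 J.2.1)
  linarith

lemma s4_ge {n : ℕ} (i : Fin n) (J : Q n)
    (h : i = J.1 ∨ i = J.2.1 ∨ i = J.2.2.1 ∨ i = J.2.2.2) : 1 ≤ s4 i J := by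
  have h1 := ind_nonneg i J.1
  have h2 := ind_nonneg i J.2.1
  have h3 := ind_nonneg i J.2.2.1
  have h4 := ind_nonneg i J.2.2.2
  have hs : ∀ j : Fin n, i = j → ind i j = 1 := fun j hj => by simp [ind, hj]
  unfold s4
  rcases h with h | h | h | h <;> have := hs _ h <;> linarith

/-- distinct quadruple -/
def Dist {n : ℕ} (I : Q n) : Prop :=
  I.1 ≠ I.2.1 ∧ I.1 ≠ I.2.2.1 ∧ I.1 ≠ I.2.2.2 ∧ I.2.1 ≠ I.2.2.1 ∧ I.2.1 ≠ I.2.2.2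
    ∧ I.2.2.1 ≠ I.2.2.2

/-- four-node set -/
def nodes {n : ℕ} (J : Q n) : Finset (Fin n) := {J.1, J.2.1, J.2.2.1, J.2.2.2}

lemma share_ge {n : ℕ} (I J : Q n) (i : Fin n) (hi : i ∈ nodes I) (hj : i ∈ nodes J) :
    1 ≤ share I J := by
  have hs := s4_ge i J (by simpa [nodes] using hj)
  have h1 := s4_nonneg I.1 J
  have h2 := s4_nonneg I.2.1 J
  have h3 := s4_nonneg I.2.2.1 J
  have h4 := s4_nonneg I.2.2.2 J
  unfold share
  simp only [nodes, Finset.mem_insert, Finset.mem_singleton] at hi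
  rcases hi with h | h | h | h <;> rw [h] at hs <;> linarith

lemma exE {n : ℕ} {i j : Fin n} (h : i ≠ j) : ∃ q : U n, q.1 = (i, j) ∨ q.1 = (j, i) := by
  rcases lt_or_gt_of_ne h with h | h
  · exact ⟨⟨(i, j), h⟩, Or.inl rfl⟩
  · exact ⟨⟨(j, i), h⟩, Or.inr rfl⟩

section covs2
variable {Ω : Type} [MeasurableSpace Ω] {P : Measure Ω} {n r : ℕ} (sbm : SBM Ω P n r)

lemma Y_eq {i j : Fin n} {q : U n} (h : q.1 = (i, j) ∨ q.1 = (j, i)) : Y sbm q = sbm.X i j := by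
  unfold Y
  rcases h with h | h
  · rw [h]
  · rw [h, sbm.X_symm]

variable {α₁ K α₂ : ℝ → ℝ} {C M m1 m2 : ℝ}

open Classical in
/-- indexed summand -/
noncomputable def TT (α₁ K α₂ : ℝ → ℝ) (I : Q n) : Ω → ℝ := fun ω =>
  if Dist I then α₁ (sbm.X I.1 I.2.1 ω) * K (sbm.X I.2.1 I.2.2.1 ω) * α₂ (sbm.X I.2.2.1 I.2.2.2 ω)
  else 0

lemma TT_not {I : Q n} (h : ¬ Dist I) : TT sbm α₁ K α₂ I = 0 := by
  funext ω; simp [TT, h]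

lemma TT_dist {I : Q n} (h : Dist I) : ∃ a b c : U n,
    TT sbm α₁ K α₂ I = T sbm α₁ K α₂ a b c ∧ a ≠ b ∧ a ≠ c ∧ b ≠ c ∧
    (b.1 = (I.2.1, I.2.2.1) ∨ b.1 = (I.2.2.1, I.2.1)) ∧
    ∀ q ∈ ({a, b, c} : Finset (U n)), q.1.1 ∈ nodes I ∧ q.1.2 ∈ nodes I := by
  obtain ⟨i1, i2, i3, i4⟩ := I
  have h' := h
  obtain ⟨h12, h13, h14, h23, h24, h34⟩ := h'
  simp only at h12 h13 h14 h23 h24 h34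
  obtain ⟨a, ha⟩ := exE h12
  obtain ⟨b, hb⟩ := exE h23
  obtain ⟨c, hc⟩ := exE h34
  refine ⟨a, b, c, ?_, ?_, ?_, ?_, hb, ?_⟩
  · funext ω
    simp [TT, h, T, Y_eq sbm ha, Y_eq sbm hb, Y_eq sbm hc]
  · rintro rfl
    rcases ha with ha | ha <;> rw [ha] at hb <;> simp only [Prod.mk.injEq] at hb <;> tauto
  · rintro rfl
    rcases ha with ha | ha <;> rw [ha] at hc <;> simp only [Prod.mk.injEq] at hc <;> tauto
  · rintro rfl
    rcases hb with ha | ha <;> rw [ha] at hc <;> simp only [Prod.mk.injEq] at hc <;> tauto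
  · intro q hq
    simp only [Finset.mem_insert, Finset.mem_singleton] at hq
    rcases hq with rfl | rfl | rfl
    · rcases ha with ha | ha <;> rw [ha] <;> simp [nodes]
    · rcases hb with ha | ha <;> rw [ha] <;> simp [nodes]
    · rcases hc with ha | ha <;> rw [ha] <;> simp [nodes]

lemma TT_memLp (h1 : Measurable α₁) (hK : Measurable K) (h2 : Measurable α₂)
    (b1 : ∀ u, |α₁ u| ≤ C) (b2 : ∀ u, |α₂ u| ≤ C) (bK : ∀ u, |K u| ≤ M) (I : Q n) :
    MemLp (TT sbm α₁ K α₂ I) 2 P := by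
  by_cases h : Dist I
  · obtain ⟨a, b, c, e, -⟩ := TT_dist sbm (α₁ := α₁) (K := K) (α₂ := α₂) h
    rw [e]
    exact T_memLp sbm h1 hK h2 b1 b2 bK a b c
  · rw [TT_not sbm h]
    exact MemLp.zero

lemma cov_TT (f : Fin r → Fin r → ℝ → ℝ)
    (hf : ∀ z₁ z₂ x, sbm.F z₁ z₂ x = ∫ u in Set.Iic x, f z₁ z₂ u)
    (hm : ∀ z₁ z₂, Measurable (f z₁ z₂)) (h0 : ∀ z₁ z₂ u, 0 ≤ f z₁ z₂ u) (Cf : ℝ)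
    (hC : ∀ z₁ z₂ u, f z₁ z₂ u ≤ Cf)
    (h1 : Measurable α₁) (hK : Measurable K) (h2 : Measurable α₂)
    (b1 : ∀ u, |α₁ u| ≤ C) (b2 : ∀ u, |α₂ u| ≤ C) (bK : ∀ u, |K u| ≤ M)
    (hm1 : ∀ z q, ∫ ω, |K (Y sbm q ω)| ∂(mz sbm z) ≤ m1)
    (hm2 : ∀ z q, ∫ ω, |K (Y sbm q ω)| * |K (Y sbm q ω)| ∂(mz sbm z) ≤ m2) (hm2' : 0 ≤ m2)
    (I J : Q n) :
    covariance (TT sbm α₁ K α₂ I) (TT sbm α₁ K α₂ J) P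
      ≤ 2 * (C ^ 2 * m1) ^ 2 * share I J + C ^ 4 * m2 * mid I J := by
  have hF : ∀ a b x, 0 ≤ sbm.F a b x := fun a b x => by
    rw [hf]; exact integral_nonneg (h0 a b)
  have hs0 := share_nonneg I J
  have hd0 := mid_nonneg I J
  have hA : 0 ≤ 2 * (C ^ 2 * m1) ^ 2 := by positivity
  have hD : 0 ≤ C ^ 4 * m2 := by positivity
  have hr0 : 0 ≤ 2 * (C ^ 2 * m1) ^ 2 * share I J + C ^ 4 * m2 * mid I J := by positivity
  by_cases hI : Dist I
  swap
  · rw [TT_not sbm hI]; simpa using hr0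
  by_cases hJ : Dist J
  swap
  · rw [TT_not sbm hJ]; simpa using hr0
  obtain ⟨a, b, c, e, hab, hac, hbc, hb, hn⟩ := TT_dist sbm (α₁ := α₁) (K := K) (α₂ := α₂) hI
  obtain ⟨a', b', c', e', hab', hac', hbc', hb', hn'⟩ :=
    TT_dist sbm (α₁ := α₁) (K := K) (α₂ := α₂) hJ
  rw [e, e']
  by_cases hsh : ∃ i, i ∈ nodes I ∧ i ∈ nodes J
  · obtain ⟨i, hi, hj⟩ := hsh
    have hs1 := share_ge I J i hi hj
    have hA1 := mul_le_mul_of_nonneg_left hs1 hA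
    by_cases hbb : b = b'
    · subst hbb
      have hd1 : 1 ≤ mid I J := by
        have q1 := mul_nonneg (ind_nonneg I.2.1 J.2.1) (ind_nonneg I.2.2.1 J.2.2.1)
        have q2 := mul_nonneg (ind_nonneg I.2.1 J.2.2.1) (ind_nonneg I.2.2.1 J.2.1)
        have : (I.2.1 = J.2.1 ∧ I.2.2.1 = J.2.2.1) ∨ (I.2.1 = J.2.2.1 ∧ I.2.2.1 = J.2.1) := by
          rcases hb with h | h <;> rw [h] at hb' <;> simp only [Prod.mk.injEq] at hb' <;> tauto
        unfold mid
        rcases this with ⟨u, v⟩ | ⟨u, v⟩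
        · have : ind I.2.1 J.2.1 * ind I.2.2.1 J.2.2.1 = 1 := by simp [ind, u, v]
          linarith
        · have : ind I.2.1 J.2.2.1 * ind I.2.2.1 J.2.1 = 1 := by simp [ind, u, v]
          linarith
      have hD1 := mul_le_mul_of_nonneg_left hd1 hD
      have := cov_eq sbm h1 hK h2 b1 b2 bK hm1 hm2 a b c a' c'
      linarith
    · have := cov_ne sbm hF h1 hK h2 b1 b2 bK hm1 a b c a' b' c' hbb
      have : 0 ≤ C ^ 4 * m2 * mid I J := by positivity
      linarith
  · push Not at hsh
    rw [cov_disj sbm f hf hm h0 Cf hC h1 hK h2 b1 b2 bK a b c a' b' c' hab hac hbc hab' hac' hbc'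
      (nodes J) (fun q hq => ⟨hsh _ (hn q hq).1, hsh _ (hn q hq).2⟩) hn']
    exact hr0

end covs2

lemma final_arith (n : ℕ) (hn : 8 ≤ n) (A D h : ℝ) (hA : 0 ≤ A) (hD : 0 ≤ D) (hh : 0 < h) :
    (((n * (n - 1) * (n - 2) * (n - 3) : ℕ) : ℝ)⁻¹) ^ 2 *
      (A * (16 * (n : ℝ) ^ 7) + D * h⁻¹ * (2 * (n : ℝ) ^ 6))
      ≤ (64 * (16 * A + 2 * D)) * ((n : ℝ)⁻¹ + ((n : ℝ) ^ 2 * h)⁻¹) := by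
  have hn' : (8 : ℝ) ≤ n := by exact_mod_cast hn
  have hc : ((n * (n - 1) * (n - 2) * (n - 3) : ℕ) : ℝ)
      = (n : ℝ) * (n - 1) * (n - 2) * (n - 3) := by
    rw [Nat.cast_mul, Nat.cast_mul, Nat.cast_mul, Nat.cast_sub (by omega), Nat.cast_sub (by omega),
      Nat.cast_sub (by omega)]
    norm_num
  have hN : (n : ℝ) ^ 4 / 8 ≤ ((n * (n - 1) * (n - 2) * (n - 3) : ℕ) : ℝ) := by
    rw [hc]
    calc (n : ℝ) ^ 4 / 8 = n * (n / 2) * (n / 2) * (n / 2) := by ring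
      _ ≤ _ := by
        have e1 : (n : ℝ) / 2 ≤ n - 1 := by linarith
        have e2 : (n : ℝ) / 2 ≤ n - 2 := by linarith
        have e3 : (n : ℝ) / 2 ≤ n - 3 := by linarith
        have : (0 : ℝ) ≤ n - 1 := by linarith
        have : (0 : ℝ) ≤ n - 2 := by linarith
        gcongr
  have hpos : (0 : ℝ) < n := by linarith
  have h4 : (((n * (n - 1) * (n - 2) * (n - 3) : ℕ) : ℝ)⁻¹) ^ 2 ≤ (((n : ℝ) ^ 4 / 8)⁻¹) ^ 2 := by
    gcongr
  calc _ ≤ (((n : ℝ) ^ 4 / 8)⁻¹) ^ 2 *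
      (A * (16 * (n : ℝ) ^ 7) + D * h⁻¹ * (2 * (n : ℝ) ^ 6)) := by gcongr
    _ = 64 * 16 * A * (n : ℝ)⁻¹ + 64 * 2 * D * ((n : ℝ) ^ 2 * h)⁻¹ := by
        field_simp
        ring
    _ ≤ _ := by
        have e1 : 0 ≤ (n : ℝ)⁻¹ := by positivity
        have e2 : 0 ≤ ((n : ℝ) ^ 2 * h)⁻¹ := by positivity
        nlinarith [mul_nonneg hA e2, mul_nonneg hD e1]

lemma kernel_int (k : ℝ → ℝ) (x h : ℝ) (hh : 0 < h) (hi : Integrable k) :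
    Integrable (fun u => |h⁻¹ * k ((u - x) / h)|) ∧
      ∫ u, |h⁻¹ * k ((u - x) / h)| = ∫ u, |k u| := by
  constructor
  · have h1 : Integrable (fun u => k (u / h)) := hi.comp_div hh.ne'
    have h2 : Integrable (fun u => k ((u - x) / h)) := h1.comp_sub_right x
    exact (h2.const_mul _).abs
  · simp_rw [abs_mul, abs_of_pos (inv_pos.2 hh)]
    rw [integral_const_mul, integral_sub_right_eq_self (fun u => |k (u / h)|) x,
      Measure.integral_comp_div (fun u => |k u|) h, abs_of_pos hh, smul_eq_mul]
    field_simp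

end SBMaux

/-- variance order of the smoothed fourth-order network average. Under
the weighted stochastic block model with `n ≥ 8` nodes, bounded measurable functions
`α₁, α₂` (bounded by `Cα`), a bounded kernel `k` (bounded by `Ck`, with `∫ |k| ≤ Ck` and
`∫ k = 1`), and conditional densities `f z₁ z₂` uniformly bounded by `Cf`, the statistic
`S_n = [n(n−1)(n−2)(n−3)]⁻¹ ∑_{i₁ ≠ i₂ ≠ i₃ ≠ i₄} α₁(X_{i₁,i₂}) h⁻¹ k((X_{i₂,i₃} − x)/h)
α₂(X_{i₃,i₄})` over ordered quadruples of distinct nodes satisfies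
`Var(S_n) ≤ C (n⁻¹ + (n² h)⁻¹)` for a constant `C` independent of `n` and of
`h ∈ (0, 1]`; in particular the variance is of order `n⁻¹` whenever `n h → ∞`. -/
theorem variance_order_smoothed_fourth_order_average (Cα Ck Cf : ℝ) :
    ∃ C : ℝ, ∀ (n r : ℕ), 8 ≤ n →
      ∀ (Ω : Type) (_ : MeasurableSpace Ω) (ℙ : Measure Ω) (sbm : SBM Ω ℙ n r)
        (f : Fin r → Fin r → ℝ → ℝ),
        (∀ z₁ z₂ x, sbm.F z₁ z₂ x = ∫ u in Set.Iic x, f z₁ z₂ u) →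
        (∀ z₁ z₂, Measurable (f z₁ z₂)) →
        (∀ z₁ z₂ u, 0 ≤ f z₁ z₂ u) →
        (∀ z₁ z₂ u, f z₁ z₂ u ≤ Cf) →
      ∀ (α₁ α₂ : ℝ → ℝ), Measurable α₁ → Measurable α₂ →
        (∀ u, |α₁ u| ≤ Cα) → (∀ u, |α₂ u| ≤ Cα) →
      ∀ (k : ℝ → ℝ), Measurable k → (∀ u, |k u| ≤ Ck) →
        ((∫ u, |k u|) ≤ Ck) → ((∫ u, k u) = 1) →
      ∀ (x h : ℝ), 0 < h → h ≤ 1 →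
        ProbabilityTheory.variance
          (fun ω =>
            ((n * (n - 1) * (n - 2) * (n - 3) : ℕ) : ℝ)⁻¹ *
              ∑ i₁ : Fin n, ∑ i₂ : Fin n, ∑ i₃ : Fin n, ∑ i₄ : Fin n,
                if i₁ ≠ i₂ ∧ i₁ ≠ i₃ ∧ i₁ ≠ i₄ ∧ i₂ ≠ i₃ ∧ i₂ ≠ i₄ ∧ i₃ ≠ i₄ then
                  α₁ (sbm.X i₁ i₂ ω) * (h⁻¹ * k ((sbm.X i₂ i₃ ω - x) / h))
                    * α₂ (sbm.X i₃ i₄ ω)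
                else 0) ℙ
          ≤ C * ((n : ℝ)⁻¹ + ((n : ℝ) ^ 2 * h)⁻¹) := by
  refine ⟨64 * (16 * (2 * (Cα ^ 2 * (Cf * Ck)) ^ 2) + 2 * (Cα ^ 4 * (Ck * (Cf * Ck)))), ?_⟩
  intro n r hn Ω _ P sbm f hf hm h0 hC α₁ α₂ h1 h2 b1 b2 k hk bk ik ik1 x h hh hh1
  have := sbm.prob
  have hki : Integrable k := by
    by_contra hcon
    rw [integral_undef hcon] at ik1
    exact zero_ne_one ik1
  obtain ⟨hKi, hKe⟩ := SBMaux.kernel_int k x h hh hki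
  set K : ℝ → ℝ := fun u => h⁻¹ * k ((u - x) / h) with hKdef
  have hK : Measurable K := by fun_prop
  have hCk : 0 ≤ Ck := (abs_nonneg _).trans (bk 0)
  have hr : 0 < n := by omega
  have hCf : 0 ≤ Cf := by
    have hne : Nonempty Ω := by
      by_contra hcon
      rw [not_nonempty_iff] at hcon
      have h3 := measure_univ (μ := P)
      rw [Set.univ_eq_empty_iff.2 hcon] at h3
      simp at h3
    obtain ⟨ω⟩ := hne
    have z := sbm.Z ⟨0, hr⟩ ω
    exact (h0 z z 0).trans (hC z z 0)
  have bK : ∀ u, |K u| ≤ h⁻¹ * Ck := fun u => by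
    rw [hKdef]
    simp only
    rw [abs_mul, abs_of_pos (inv_pos.2 hh)]
    exact mul_le_mul_of_nonneg_left (bk _) (inv_pos.2 hh).le
  have hm1 : ∀ z q, ∫ ω, |K (SBMaux.Y sbm q ω)| ∂(SBMaux.mz sbm z) ≤ Cf * Ck := fun z q => by
    refine (SBMaux.edge_bound sbm f hf hm h0 Cf hC z q (fun u => |K u|) hK.abs
      (fun _ => abs_nonneg _) hKi).trans ?_
    rw [hKe]
    exact mul_le_mul_of_nonneg_left ik hCf
  have hm2 : ∀ z q, ∫ ω, |K (SBMaux.Y sbm q ω)| * |K (SBMaux.Y sbm q ω)| ∂(SBMaux.mz sbm z)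
      ≤ h⁻¹ * (Ck * (Cf * Ck)) := fun z q => by
    have := SBMaux.mz_prob sbm z
    calc _ ≤ ∫ ω, h⁻¹ * Ck * |K (SBMaux.Y sbm q ω)| ∂(SBMaux.mz sbm z) := by
          apply integral_mono_of_nonneg
          · exact Filter.Eventually.of_forall fun ω => by positivity
          · refine Integrable.const_mul ?_ _
            exact Integrable.of_bound (hK.comp (SBMaux.Y_meas sbm q)).abs.aestronglyMeasurable
              (h⁻¹ * Ck) (Filter.Eventually.of_forall fun ω => by simpa using bK _)
          · exact Filter.Eventually.of_forall fun ω =>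
              mul_le_mul_of_nonneg_right (bK _) (abs_nonneg _)
      _ ≤ h⁻¹ * Ck * (Cf * Ck) := by
          rw [integral_const_mul]
          exact mul_le_mul_of_nonneg_left (hm1 z q) (by positivity)
      _ = _ := by ring
  have hsum : (fun ω => ∑ i₁ : Fin n, ∑ i₂ : Fin n, ∑ i₃ : Fin n, ∑ i₄ : Fin n,
                if i₁ ≠ i₂ ∧ i₁ ≠ i₃ ∧ i₁ ≠ i₄ ∧ i₂ ≠ i₃ ∧ i₂ ≠ i₄ ∧ i₃ ≠ i₄ then
                  α₁ (sbm.X i₁ i₂ ω) * (h⁻¹ * k ((sbm.X i₂ i₃ ω - x) / h))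
                    * α₂ (sbm.X i₃ i₄ ω)
                else 0) = fun ω => ∑ I : SBMaux.Q n, SBMaux.TT sbm α₁ K α₂ I ω := by
    funext ω
    simp only [Fintype.sum_prod_type, SBMaux.TT, SBMaux.Dist]
    refine Finset.sum_congr rfl fun i1 _ => Finset.sum_congr rfl fun i2 _ =>
      Finset.sum_congr rfl fun i3 _ => Finset.sum_congr rfl fun i4 _ => ?_
    congr
  rw [ProbabilityTheory.variance_const_mul, hsum, ProbabilityTheory.variance_fun_sum
    (fun I => SBMaux.TT_memLp sbm h1 hK h2 b1 b2 bK I)]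
  refine le_trans ?_ (SBMaux.final_arith n hn _ _ h (by positivity) (by positivity) hh)
  refine mul_le_mul_of_nonneg_left ?_ (sq_nonneg _)
  calc _ ≤ ∑ I : SBMaux.Q n, ∑ J : SBMaux.Q n,
        (2 * (Cα ^ 2 * (Cf * Ck)) ^ 2 * SBMaux.share I J
          + Cα ^ 4 * (h⁻¹ * (Ck * (Cf * Ck))) * SBMaux.mid I J) :=
        Finset.sum_le_sum fun I _ => Finset.sum_le_sum fun J _ =>
          SBMaux.cov_TT sbm f hf hm h0 Cf hC h1 hK h2 b1 b2 bK hm1 hm2 (by positivity) I J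
    _ = _ := by
        simp only [Finset.sum_add_distrib, ← Finset.mul_sum, SBMaux.share_sum, SBMaux.mid_sum]
        ring
end
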